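/- arXiv:1901.03617 — 2 statements merged into one kernel-verified Lean document; each statement's English description precedes it below -/
import Mathlib

section
/- The lamplighter group L = (⨁_{ℤ} ℤ/2ℤ) ⋊ ℤ with the switch-walk-switch measure μ = μ₁ * μ₂ * μ₁ is entropy noise sensitive. -/
open Filter

namespace NS

/-- A probability measure on a countable (discrete) set, as a nonnegative
function summing to 1. -/
def IsProbMeasure {E : Type*} (ξ : E → ℝ) : Prop :=
  (∀ x, 0 ≤ ξ x) ∧ ∑' x, ξ x = 1

/-- Convolution of two measures on a group. -/
noncomputable def conv {G : Type*} [Group G] (μ ν : G → ℝ) : G → ℝ :=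
  fun g => ∑' h, μ h * ν (h⁻¹ * g)

/-- `convPow μ n` is the `n`-fold convolution `μ^{*n}`, the law of the random
walk at time `n` (with `μ^{*0}` the Dirac mass at the identity). -/
noncomputable def convPow {G : Type*} [Group G] (μ : G → ℝ) : ℕ → G → ℝ
  | 0 => ({1} : Set G).indicator (fun _ => (1 : ℝ))
  | n + 1 => conv μ (convPow μ n)

/-- The diagonal measure `μ^diag` on `G × G`. -/
noncomputable def diagM {G : Type*} [Group G] (μ : G → ℝ) : G × G → ℝ :=
  {p : G × G | p.1 = p.2}.indicator (fun p => μ p.1)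

/-- Product of two measures. -/
def prodM {G H : Type*} (μ : G → ℝ) (ν : H → ℝ) : G × H → ℝ :=
  fun p => μ p.1 * ν p.2

/-- The noise kernel `π^ρ = (1-ρ)·μ^diag + ρ·(μ×μ)` on `G × G`. -/
noncomputable def noise {G : Type*} [Group G] (μ : G → ℝ) (ρ : ℝ) : G × G → ℝ :=
  fun p => (1 - ρ) * diagM μ p + ρ * prodM μ μ p

/-- The `ℓ¹` distance between two measures. -/
noncomputable def l1dist {E : Type*} (ξ₁ ξ₂ : E → ℝ) : ℝ :=
  ∑' x, |ξ₁ x - ξ₂ x|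

/-- `(G,μ)` is `ℓ¹`-noise sensitive. -/
def L1NoiseSensitive {G : Type*} [Group G] (μ : G → ℝ) : Prop :=
  ∀ ρ ∈ Set.Ioo (0 : ℝ) 1,
    Tendsto
      (fun n => l1dist (convPow (noise μ ρ) n) (prodM (convPow μ n) (convPow μ n)))
      atTop (nhds 0)

/-- Shannon entropy of a measure. -/
noncomputable def entropy {E : Type*} (ξ : E → ℝ) : ℝ :=
  -∑' x, ξ x * Real.log (ξ x)

/-- `(G,μ)` is entropy noise sensitive: `H(Y_n^ρ | X_n) / H(X_n) → 1`, where
`H(Y_n^ρ | X_n) = H(π_n^ρ) - H(μ_n)`. -/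
def EntropyNoiseSensitive {G : Type*} [Group G] (μ : G → ℝ) : Prop :=
  ∀ ρ ∈ Set.Ioo (0 : ℝ) 1,
    Tendsto
      (fun n => (entropy (convPow (noise μ ρ) n) - entropy (convPow μ n))
        / entropy (convPow μ n))
      atTop (nhds 1)

/-- A function is `μ`-harmonic. -/
def Harmonic {G : Type*} [Group G] (μ : G → ℝ) (f : G → ℝ) : Prop :=
  ∀ y, f y = ∑' x, μ x * f (y * x)

/-- `(G,μ)` is Liouville: every bounded `μ`-harmonic function is constant. -/
def Liouville {G : Type*} [Group G] (μ : G → ℝ) : Prop :=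
  ∀ f : G → ℝ, Harmonic μ f → (∃ C, ∀ g, |f g| ≤ C) → ∀ x y, f x = f y

/-- Word distance for a generating set `S`: least length of a word in `S`
evaluating to `x⁻¹ * y`. -/
noncomputable def wordDist {G : Type*} [Group G] (S : Set G) (x y : G) : ℕ :=
  sInf {n : ℕ | ∃ w : List G, w.length = n ∧ (∀ g ∈ w, g ∈ S) ∧ w.prod = x⁻¹ * y}

/-- Expected distance `E d(X_n, X'_n)` between two independent samples of law `ξ`. -/
noncomputable def spread {G : Type*} [Group G] (S : Set G) (ξ : G → ℝ) : ℝ :=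
  ∑' p : G × G, ξ p.1 * ξ p.2 * (wordDist S p.1 p.2 : ℝ)

/-- Expected distance between the two coordinates under a measure on `G × G`. -/
noncomputable def avgDist {G : Type*} [Group G] (S : Set G) (π : G × G → ℝ) : ℝ :=
  ∑' p : G × G, π p * (wordDist S p.1 p.2 : ℝ)

/-- `ν` is a coupling of `ξ₁` and `ξ₂`. -/
def IsCoupling {E₁ E₂ : Type*} (ν : E₁ × E₂ → ℝ) (ξ₁ : E₁ → ℝ) (ξ₂ : E₂ → ℝ) : Prop :=
  (∀ p, 0 ≤ ν p) ∧ (∀ x, ∑' y, ν (x, y) = ξ₁ x) ∧ (∀ y, ∑' x, ν (x, y) = ξ₂ y)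

/-- `U^s(ξ₁,ξ₂)`: infimum over couplings `ν` of `ν(d(x,y) ≥ s)`. -/
noncomputable def Ufn {E₁ E₂ : Type*} (d : E₁ → E₂ → ℝ) (s : ℝ)
    (ξ₁ : E₁ → ℝ) (ξ₂ : E₂ → ℝ) : ℝ :=
  sInf {r : ℝ | ∃ ν : E₁ × E₂ → ℝ, IsCoupling ν ξ₁ ξ₂ ∧
    r = ∑' p : E₁ × E₂, {q : E₁ × E₂ | s ≤ d q.1 q.2}.indicator ν p}

/-- The `ℓ¹` product metric on `G × G` associated to the word metric of `S`. -/
noncomputable def wordDistProd {G : Type*} [Group G] (S : Set G) :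
    G × G → G × G → ℝ :=
  fun p q => (wordDist S p.1 q.1 : ℝ) + (wordDist S p.2 q.2 : ℝ)

/-- The lamp configuration group `⨁_ℤ ℤ/2ℤ` (finitely supported functions). -/
abbrev LampConf := ℤ →₀ ZMod 2

/-- The shift automorphism: `(t · f)(x) = f (x + t)`. -/
noncomputable def lampShiftAux (t : ℤ) : LampConf ≃+ LampConf :=
  Finsupp.domCongr (Equiv.subRight t)

lemma lampShiftAux_zero : lampShiftAux 0 = AddEquiv.refl LampConf :=
  AddEquiv.ext fun g => Finsupp.ext fun x => by
    simp [lampShiftAux, Finsupp.domCongr_apply]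

lemma lampShiftAux_add (s t : ℤ) :
    lampShiftAux (s + t) = (lampShiftAux t).trans (lampShiftAux s) :=
  AddEquiv.ext fun g => Finsupp.ext fun x => by
    simp [lampShiftAux, Finsupp.domCongr_apply, add_assoc]

/-- The shift action of `ℤ` on `⨁_ℤ ℤ/2ℤ`, as a homomorphism into the
automorphism group. -/
noncomputable def lampShift :
    Multiplicative ℤ →* MulAut (Multiplicative LampConf) where
  toFun t := AddEquiv.toMultiplicative (lampShiftAux t.toAdd)
  map_one' := by
    refine MulEquiv.ext fun f => ?_
    show AddEquiv.toMultiplicative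
      (lampShiftAux (Multiplicative.toAdd (1 : Multiplicative ℤ))) f = f
    rw [show Multiplicative.toAdd (1 : Multiplicative ℤ) = 0 from rfl, lampShiftAux_zero]
    rfl
  map_mul' s t := by
    refine MulEquiv.ext fun f => ?_
    show AddEquiv.toMultiplicative
      (lampShiftAux (Multiplicative.toAdd (s * t))) f = _
    rw [show Multiplicative.toAdd (s * t)
        = Multiplicative.toAdd s + Multiplicative.toAdd t from rfl, lampShiftAux_add]
    rfl

/-- The lamplighter group `L = (⨁_ℤ ℤ/2ℤ) ⋊ ℤ`. -/
abbrev Lamplighter := SemidirectProduct (Multiplicative LampConf) (Multiplicative ℤ) lampShift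

/-- The lamp switch `δ` at the origin: the configuration equal to `1` at `0`. -/
noncomputable def lampDelta : Lamplighter :=
  ⟨Multiplicative.ofAdd (Finsupp.single 0 1), 1⟩

/-- The right move `(0, 1)` of the lighter. -/
noncomputable def lampRight : Lamplighter := ⟨1, Multiplicative.ofAdd 1⟩

/-- The left move `(0, -1)` of the lighter. -/
noncomputable def lampLeft : Lamplighter := ⟨1, Multiplicative.ofAdd (-1)⟩

/-- The switch measure `μ₁`, uniform on `{(0,0), (δ,0)}`. -/
noncomputable def muSwitch : Lamplighter → ℝ :=
  fun g => ({1} : Set Lamplighter).indicator (fun _ => (1:ℝ)/2) g +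
    ({lampDelta} : Set Lamplighter).indicator (fun _ => (1:ℝ)/2) g

/-- The walk measure `μ₂`, uniform on `{(0,1), (0,-1)}`. -/
noncomputable def muWalk : Lamplighter → ℝ :=
  fun g => ({lampRight} : Set Lamplighter).indicator (fun _ => (1:ℝ)/2) g +
    ({lampLeft} : Set Lamplighter).indicator (fun _ => (1:ℝ)/2) g

/-- The switch-walk-switch measure `μ = μ₁ * μ₂ * μ₁`. -/
noncomputable def muSWS : Lamplighter → ℝ :=
  conv muSwitch (conv muWalk muSwitch)


open Finset in
/-- push-forward of a weight. -/
noncomputable def push {Ω G : Type*} [Fintype Ω] (w : Ω → ℝ) (φ : Ω → G) : G → ℝ :=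
  open Classical in fun g => ∑ ω, if φ ω = g then w ω else 0

lemma tsum_push {Ω G : Type*} [Fintype Ω] (w : Ω → ℝ) (φ : Ω → G) (F : G → ℝ) :
    ∑' g, push w φ g * F g = ∑ ω, w ω * F (φ ω) := by
  classical
  unfold push
  simp_rw [Finset.sum_mul]
  rw [Summable.tsum_finsetSum]
  · refine Finset.sum_congr rfl fun ω _ => ?_
    rw [tsum_eq_single (φ ω)]
    · simp
    · intro b hb; simp [hb.symm]
  · intro ω _
    refine summable_of_ne_finset_zero (s := {φ ω}) ?_
    intro b hb
    simp at hb
    simp [Ne.symm hb]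

lemma sum_push {Ω G : Type*} [Fintype Ω] (w : Ω → ℝ) (φ : Ω → G) (F : G → ℝ)
    (S : Finset G) (hS : ∀ ω, φ ω ∈ S) :
    ∑ g ∈ S, push w φ g * F g = ∑ ω, w ω * F (φ ω) := by
  rw [← tsum_push, tsum_eq_sum]
  intro b hb
  have : push w φ b = 0 := by
    unfold push
    refine Finset.sum_eq_zero fun ω _ => ?_
    rw [if_neg]
    rintro rfl
    exact hb (hS ω)
  simp [this]

lemma push_nonneg {Ω G : Type*} [Fintype Ω] {w : Ω → ℝ} (hw : ∀ ω, 0 ≤ w ω) (φ : Ω → G) (g : G) :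
    0 ≤ push w φ g := by
  unfold push
  refine Finset.sum_nonneg fun ω _ => ?_
  split_ifs
  · exact hw ω
  · exact le_rfl

lemma push_pos {Ω G : Type*} [Fintype Ω] {w : Ω → ℝ} (hw : ∀ ω, 0 < w ω) (φ : Ω → G) (ω : Ω) :
    0 < push w φ (φ ω) := by
  unfold push
  refine Finset.sum_pos' (fun ω _ => ?_) ⟨ω, Finset.mem_univ _, by simp [hw]⟩
  split_ifs
  · exact (hw _).le
  · exact le_rfl

lemma conv_push {Ω Ω' G : Type*} [Fintype Ω] [Fintype Ω'] [Group G] (w : Ω → ℝ) (φ : Ω → G)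
    (w' : Ω' → ℝ) (φ' : Ω' → G) :
    conv (push w φ) (push w' φ') =
      push (fun p : Ω × Ω' => w p.1 * w' p.2) (fun p => φ p.1 * φ' p.2) := by
  classical
  funext g
  unfold conv
  rw [tsum_push w φ (fun h => push w' φ' (h⁻¹ * g))]
  unfold push
  rw [Fintype.sum_prod_type]
  refine Finset.sum_congr rfl fun ω _ => ?_
  rw [Finset.mul_sum]
  refine Finset.sum_congr rfl fun ω' _ => ?_
  simp only [mul_ite, mul_zero, eq_inv_mul_iff_mul_eq]

lemma push_equiv {Ω Ω' G : Type*} [Fintype Ω] [Fintype Ω'] (e : Ω ≃ Ω') (w : Ω → ℝ) (φ : Ω → G)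
    (w' : Ω' → ℝ) (φ' : Ω' → G) (h1 : ∀ x, w' (e x) = w x) (h2 : ∀ x, φ' (e x) = φ x) :
    push w φ = push w' φ' := by
  classical
  funext g
  unfold push
  rw [← e.sum_comp]
  simp only [h1, h2]

/-- ordered product of the steps -/
def PP {Ω G : Type*} [Group G] (φ : Ω → G) : (n : ℕ) → (Fin n → Ω) → G
  | 0, _ => 1
  | n + 1, x => φ (x 0) * PP φ n (Fin.tail x)

lemma convPow_push {Ω G : Type*} [Fintype Ω] [Group G] (w : Ω → ℝ) (φ : Ω → G) (n : ℕ) :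
    convPow (push w φ) n = push (fun x : Fin n → Ω => ∏ i, w (x i)) (PP φ n) := by
  classical
  induction n with
  | zero =>
    funext g
    simp only [convPow, push, PP, Finset.univ_unique, Finset.sum_singleton, Set.indicator,
      Set.mem_singleton_iff]
    simp [eq_comm]
  | succ n ih =>
    rw [convPow, ih, conv_push]
    refine push_equiv (Fin.consEquiv (fun _ : Fin (n+1) => Ω)) _ _ _ _ ?_ ?_
    · rintro ⟨a, x⟩
      simp [Fin.prod_univ_succ]
    · rintro ⟨a, x⟩
      rfl

lemma entropy_push {Ω G : Type*} [Fintype Ω] (w : Ω → ℝ) (φ : Ω → G) :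
    entropy (push w φ) = - ∑ ω, w ω * Real.log (push w φ (φ ω)) := by
  unfold entropy
  rw [tsum_push w φ (fun g => Real.log (push w φ g))]

/-- Gibbs' inequality. -/
lemma gibbs {Ω G : Type*} [Fintype Ω] {w : Ω → ℝ} (hw : ∀ ω, 0 < w ω) (h1 : ∑ ω, w ω = 1)
    (φ : Ω → G) (q : G → ℝ) (hq0 : ∀ ω, 0 < q (φ ω)) (S : Finset G) (hS : ∀ ω, φ ω ∈ S)
    (hq : ∀ g, 0 ≤ q g) (hqS : ∑ g ∈ S, q g ≤ 1) :
    entropy (push w φ) ≤ - ∑ ω, w ω * Real.log (q (φ ω)) := by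
  rw [entropy_push]
  have hp := push_pos hw φ
  have key : ∑ ω, w ω * (q (φ ω) / push w φ (φ ω) - 1) ≤ 0 := by
    have h2 : ∑ ω, w ω * (q (φ ω) / push w φ (φ ω)) ≤ 1 := by
      rw [← sum_push w φ (fun g => q g / push w φ g) S hS]
      refine le_trans (Finset.sum_le_sum fun g _ => ?_) hqS
      by_cases h : push w φ g = 0
      · simp [h, hq]
      · rw [mul_div_cancel₀ _ h]
    simp only [mul_sub, Finset.sum_sub_distrib, mul_one, h1]
    linarith
  have h3 : ∑ ω, w ω * Real.log (q (φ ω)) - ∑ ω, w ω * Real.log (push w φ (φ ω)) ≤ 0 := by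
    rw [← Finset.sum_sub_distrib]
    refine le_trans (Finset.sum_le_sum fun ω _ => ?_) key
    rw [← mul_sub, ← Real.log_div (hq0 ω).ne' (hp ω).ne']
    exact mul_le_mul_of_nonneg_left (Real.log_le_sub_one_of_pos (div_pos (hq0 ω) (hp ω))) (hw ω).le
  linarith

lemma entropy_pair_le {Ω G : Type*} [Fintype Ω] {w : Ω → ℝ} (hw : ∀ ω, 0 < w ω)
    (h1 : ∑ ω, w ω = 1) (φ ψ : Ω → G) :
    entropy (push w (fun ω => (φ ω, ψ ω))) ≤ entropy (push w φ) + entropy (push w ψ) := by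
  classical
  have e1 : ∀ (f : Ω → G), ∑ g ∈ Finset.univ.image f, push w f g = 1 := by
    intro f
    have := sum_push w f (fun _ => 1) (Finset.univ.image f) (by simp)
    simpa [h1] using this
  refine le_trans (gibbs hw h1 _ (fun g : G × G => push w φ g.1 * push w ψ g.2) ?_
    (Finset.univ.image φ ×ˢ Finset.univ.image ψ) ?_ ?_ ?_) ?_
  · intro ω
    exact mul_pos (push_pos hw φ ω) (push_pos hw ψ ω)
  · intro ω
    simp
  · intro g
    exact mul_nonneg (push_nonneg (fun ω => (hw ω).le) _ _) (push_nonneg (fun ω => (hw ω).le) _ _)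
  · rw [Finset.sum_product, ← Finset.sum_mul_sum, e1, e1]
    norm_num
  · rw [entropy_push, entropy_push, ← neg_add, ← Finset.sum_add_distrib]
    refine neg_le_neg (Finset.sum_le_sum fun ω _ => ?_)
    simp only
    rw [Real.log_mul (push_pos hw φ ω).ne' (push_pos hw ψ ω).ne', mul_add]

lemma entropy_lower {C D G : Type*} [Fintype C] [Fintype D] [Nonempty D] {W : C → ℝ}
    (hW : ∀ c, 0 ≤ W c) (h1 : ∑ c, W c = 1) (Φ : C × D → G) (v : C → ℕ)
    (hv : ∀ c g, (open Classical in (Finset.univ.filter fun d => Φ (c, d) = g).card) * 2 ^ v c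
      ≤ Fintype.card D) :
    Real.log 2 * ∑ c, W c * v c ≤
      entropy (push (fun x : C × D => W x.1 * (Fintype.card D : ℝ)⁻¹) Φ) := by
  classical
  set N : ℝ := (Fintype.card D : ℝ) with hN
  have hN0 : 0 < N := by rw [hN]; exact_mod_cast Fintype.card_pos
  set S : Finset G := Finset.univ.image Φ
  set pc : C → G → ℝ := fun c => push (fun _ : D => N⁻¹) (fun d => Φ (c, d)) with hpc
  have hpp : ∀ g, push (fun x : C × D => W x.1 * N⁻¹) Φ g = ∑ c, W c * pc c g := by
    intro g
    simp only [hpc, push, Fintype.sum_prod_type, Finset.mul_sum, mul_ite, mul_zero]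
  have hsum : ∀ c, ∑ g ∈ S, pc c g = 1 := by
    intro c
    have := sum_push (fun _ : D => N⁻¹) (fun d => Φ (c, d)) (fun _ => 1) S (by
      intro d; simp [S])
    simp only [mul_one] at this
    rw [this]
    simp [← hN, hN0.ne']
  have hpc0 : ∀ c g, 0 ≤ pc c g := fun c g => push_nonneg (fun _ => by positivity) _ _
  have hle : ∀ c g, pc c g * (v c * Real.log 2) ≤ Real.negMulLog (pc c g) := by
    intro c g
    rcases (hpc0 c g).eq_or_lt with h | h
    · simp [← h]
    · have hb : pc c g * 2 ^ v c ≤ 1 := by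
        have h2 := hv c g
        have h3 : pc c g = ((Finset.univ.filter fun d => Φ (c, d) = g).card : ℝ) * N⁻¹ := by
          simp only [hpc, push, ← Finset.sum_filter]
          simp
        rw [h3, mul_right_comm, ← div_eq_mul_inv, div_le_one hN0, hN]
        exact_mod_cast h2
      have h4 : Real.log (pc c g * 2 ^ v c) ≤ 0 := Real.log_nonpos (by positivity) hb
      rw [Real.log_mul h.ne' (by positivity), Real.log_pow] at h4
      rw [Real.negMulLog, neg_mul, ← mul_neg]
      exact mul_le_mul_of_nonneg_left (by linarith) h.le
  have hent : entropy (push (fun x : C × D => W x.1 * N⁻¹) Φ)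
      = ∑ g ∈ S, Real.negMulLog (push (fun x : C × D => W x.1 * N⁻¹) Φ g) := by
    rw [entropy_push, ← sum_push _ Φ (fun g => Real.log
      (push (fun x : C × D => W x.1 * N⁻¹) Φ g)) S (by simp [S]), ← Finset.sum_neg_distrib]
    simp [Real.negMulLog]
  rw [hent]
  calc Real.log 2 * ∑ c, W c * v c
      = ∑ c, W c * (v c * Real.log 2) * ∑ g ∈ S, pc c g := by
        rw [Finset.mul_sum]
        refine Finset.sum_congr rfl fun c _ => ?_
        rw [hsum]; ring
    _ = ∑ g ∈ S, ∑ c, W c * (pc c g * (v c * Real.log 2)) := by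
        rw [Finset.sum_comm]
        refine Finset.sum_congr rfl fun c _ => ?_
        rw [Finset.mul_sum]
        refine Finset.sum_congr rfl fun g _ => ?_
        ring
    _ ≤ ∑ g ∈ S, ∑ c, W c * Real.negMulLog (pc c g) :=
        Finset.sum_le_sum fun g _ => Finset.sum_le_sum fun c _ =>
          mul_le_mul_of_nonneg_left (hle c g) (hW c)
    _ ≤ _ := by
        refine Finset.sum_le_sum fun g _ => ?_
        rw [hpp]
        have := Real.concaveOn_negMulLog.le_map_sum (t := Finset.univ) (w := W)
          (p := fun c => pc c g) (fun c _ => hW c) h1 (fun c _ => hpc0 c g)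
        simpa using this

/-- weighted sum over words -/
noncomputable def Ex {Ω : Type*} [Fintype Ω] (w : Ω → ℝ) (n : ℕ) (F : (Fin n → Ω) → ℝ) : ℝ :=
  ∑ x, (∏ i, w (x i)) * F x

section Exlem
variable {Ω : Type*} [Fintype Ω] (w : Ω → ℝ)

lemma Ex_zero (F : (Fin 0 → Ω) → ℝ) : Ex w 0 F = F Fin.elim0 := by
  simp only [Ex, Finset.univ_unique, Finset.sum_singleton, Finset.univ_eq_empty,
    Finset.prod_empty, one_mul]
  congr 1

lemma Ex_succ (n : ℕ) (F : (Fin (n+1) → Ω) → ℝ) :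
    Ex w (n+1) F = ∑ a, w a * Ex w n (fun x => F (Fin.cons a x)) := by
  unfold Ex
  rw [← (Fin.consEquiv (fun _ : Fin (n+1) => Ω)).sum_comp, Fintype.sum_prod_type]
  refine Finset.sum_congr rfl fun a _ => ?_
  rw [Finset.mul_sum]
  refine Finset.sum_congr rfl fun x _ => ?_
  simp only [Fin.prod_univ_succ, mul_assoc]
  rfl

lemma Ex_add (n : ℕ) (F H : (Fin n → Ω) → ℝ) :
    Ex w n (fun x => F x + H x) = Ex w n F + Ex w n H := by
  simp [Ex, mul_add, Finset.sum_add_distrib]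

lemma Ex_mul (n : ℕ) (a : ℝ) (F : (Fin n → Ω) → ℝ) :
    Ex w n (fun x => a * F x) = a * Ex w n F := by
  simp only [Ex, Finset.mul_sum]
  refine Finset.sum_congr rfl fun x _ => ?_
  ring

variable {w} in
lemma Ex_mono (hw : ∀ a, 0 ≤ w a) (n : ℕ) {F H : (Fin n → Ω) → ℝ} (h : ∀ x, F x ≤ H x) :
    Ex w n F ≤ Ex w n H :=
  Finset.sum_le_sum fun x _ =>
    mul_le_mul_of_nonneg_left (h x) (Finset.prod_nonneg fun _ _ => hw _)

variable {w} in
lemma Ex_const (h1 : ∑ a, w a = 1) (n : ℕ) (a : ℝ) : Ex w n (fun _ => a) = a := by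
  induction n with
  | zero => rw [Ex_zero]
  | succ n ih => rw [Ex_succ]; simp only [ih, ← Finset.sum_mul, h1, one_mul]

lemma sum_prod_eq_Ex (n : ℕ) : ∑ x : Fin n → Ω, ∏ i, w (x i) = Ex w n (fun _ => 1) := by
  simp [Ex]

end Exlem

/-- control symbol: refresh flag, step of the first walk, independent step. -/
abbrev Ctl := Bool × Bool × Bool

/-- displacement -/
def sg (e : Bool) : ℤ := if e then 1 else -1

/-- weights of control symbols -/
noncomputable def wC (ρ : ℝ) (c : Ctl) : ℝ := (if c.1 then ρ else 1 - ρ) / 4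

/-- visited sites -/
def Rs : (n : ℕ) → (Fin n → Ctl) → Finset ℤ
  | 0, _ => {0}
  | n + 1, c => insert 0 ((Rs n (Fin.tail c)).image (· + sg (c 0).2.1))

/-- sites visited at refreshed steps -/
def Vs : (n : ℕ) → (Fin n → Ctl) → Finset ℤ
  | 0, _ => ∅
  | n + 1, c => (if (c 0).1 then {0} else ∅) ∪ ((Vs n (Fin.tail c)).image (· + sg (c 0).2.1))

/-- final position -/
def Ts : (n : ℕ) → (Fin n → Ctl) → ℤ
  | 0, _ => 0
  | n + 1, c => sg (c 0).2.1 + Ts n (Fin.tail c)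

lemma sg_cases (e : Bool) : sg e = 1 ∨ sg e = -1 := by
  cases e <;> simp [sg]

lemma Rs_spec (n : ℕ) (c : Fin n → Ctl) : ∃ lo hi : ℤ, Rs n c = Finset.Icc lo hi ∧
    -n ≤ lo ∧ lo ≤ 0 ∧ 0 ≤ hi ∧ hi ≤ n ∧ lo ≤ Ts n c ∧ Ts n c ≤ hi := by
  induction n with
  | zero => exact ⟨0, 0, by simp [Rs, Ts]⟩
  | succ n ih =>
    obtain ⟨lo, hi, h, h1, h2, h3, h4, h5, h6⟩ := ih (Fin.tail c)
    have hs := sg_cases (c 0).2.1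
    simp only [Rs, Ts, h]
    generalize sg (c 0).2.1 = s at *
    refine ⟨min 0 (lo + s), max 0 (hi + s), ?_, ?_, ?_, ?_, ?_, ?_, ?_⟩
    · ext z
      simp only [Finset.mem_insert, Finset.mem_image, Finset.mem_Icc]
      constructor
      · rintro (rfl | ⟨y, hy, rfl⟩) <;> omega
      · intro hz
        by_cases h0 : z = 0
        · exact Or.inl h0
        · exact Or.inr ⟨z - s, by omega, by omega⟩
    all_goals push_cast; omega

lemma Rs_card_le (n : ℕ) (c : Fin n → Ctl) : (Rs n c).card ≤ n + 1 := by
  induction n with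
  | zero => simp [Rs]
  | succ n ih =>
    refine (Finset.card_insert_le _ _).trans ?_
    have := (Finset.card_image_le (s := Rs n (Fin.tail c)) (f := (· + sg (c 0).2.1)))
    have := ih (Fin.tail c)
    omega

lemma abs_Ts_le (n : ℕ) (c : Fin n → Ctl) : |Ts n c| ≤ (Rs n c).card := by
  obtain ⟨lo, hi, h, h1, h2, h3, h4, h5, h6⟩ := Rs_spec n c
  rw [h, Int.card_Icc, abs_le]
  omega


lemma wC_pos {ρ : ℝ} (hρ : ρ ∈ Set.Ioo (0 : ℝ) 1) (c : Ctl) : 0 < wC ρ c := by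
  have h1 := hρ.1
  have h2 := hρ.2
  unfold wC
  split_ifs <;> linarith

lemma wC_sum (ρ : ℝ) : ∑ c, wC ρ c = 1 := by
  simp [wC, Fintype.sum_prod_type]
  ring

/-- the recursion for the probability that `x` is not visited at a refreshed step -/
noncomputable def Fr (ρ : ℝ) : ℕ → ℤ → ℝ
  | 0, _ => 1
  | n + 1, x => (if x = 0 then 1 - ρ else 1) * ((Fr ρ n (x - 1) + Fr ρ n (x + 1)) / 2)

lemma Fr_eq (ρ : ℝ) (n : ℕ) (x : ℤ) :
    Ex (wC ρ) n (fun c => if x ∈ Vs n c then 0 else 1) = Fr ρ n x := by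
  induction n generalizing x with
  | zero => simp [Ex_zero, Vs, Fr]
  | succ n ih =>
    have h : ∀ (a : Ctl) (c : Fin n → Ctl), (if x ∈ Vs (n+1) (Fin.cons a c : Fin (n+1) → Ctl)
        then (0:ℝ) else 1) = (if (a.1 = true ∧ x = 0) then 0 else 1) *
          (if x - sg a.2.1 ∈ Vs n c then 0 else 1) := by
      intro a c
      have : x ∈ (Vs n c).image (· + sg a.2.1) ↔ x - sg a.2.1 ∈ Vs n c := by
        simp only [Finset.mem_image]
        constructor
        · rintro ⟨y, hy, rfl⟩; simpa using hy
        · intro hy; exact ⟨_, hy, by ring⟩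
      simp only [Vs, Fin.cons_zero, Fin.tail_cons, Finset.mem_union, this]
      by_cases h1 : a.1 = true <;> by_cases h2 : x = 0 <;>
        by_cases h3 : x - sg a.2.1 ∈ Vs n c <;> simp [h1, h2]
    rw [Ex_succ]
    simp only [h, Ex_mul, ih, Fr]
    simp only [Fintype.sum_prod_type, Fintype.sum_bool, wC, sg]
    by_cases h2 : x = 0
    · simp [h2]; ring
    · simp [h2]; ring

lemma Fr_nonneg {ρ : ℝ} (hρ : ρ ∈ Set.Ioo (0 : ℝ) 1) (n : ℕ) (x : ℤ) : 0 ≤ Fr ρ n x := by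
  have h1 := hρ.1
  have h2 := hρ.2
  induction n generalizing x with
  | zero => simp [Fr]
  | succ n ih =>
    have a := ih (x-1)
    have b := ih (x+1)
    simp only [Fr]
    split_ifs
    · exact mul_nonneg (by linarith) (by linarith)
    · linarith

lemma Fr_anti {ρ : ℝ} (hρ : ρ ∈ Set.Ioo (0 : ℝ) 1) (n : ℕ) (x : ℤ) :
    Fr ρ (n+1) x ≤ Fr ρ n x := by
  have h1 := hρ.1
  have h2 := hρ.2
  induction n generalizing x with
  | zero => simp only [Fr]; split_ifs <;> linarith
  | succ n ih =>
    have a := ih (x-1)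
    have b := ih (x+1)
    rw [Fr, Fr.eq_2 ρ x n]
    refine mul_le_mul_of_nonneg_left (by linarith) ?_
    split_ifs <;> linarith

lemma bounded_affine {l : ℕ → ℝ} (h0 : ∀ k, 0 ≤ l k) (h1 : ∀ k, l k ≤ 1)
    (h : ∀ k, l (k+1) = (l k + l (k+2)) / 2) : l 1 = l 0 := by
  have hk : ∀ k : ℕ, l k = l 0 + k * (l 1 - l 0) ∧ l (k+1) = l 0 + (k+1) * (l 1 - l 0) := by
    intro k
    induction k with
    | zero => simp
    | succ k ih =>
      obtain ⟨a, b⟩ := ih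
      have := h k
      push_cast
      refine ⟨b, ?_⟩
      show l (k+2) = _
      linarith
  by_contra hne
  have hd : l 1 - l 0 ≠ 0 := sub_ne_zero.mpr hne
  obtain ⟨k, hk2⟩ := exists_nat_gt (2 / |l 1 - l 0|)
  have hp : 0 < |l 1 - l 0| := abs_pos.mpr hd
  rw [div_lt_iff₀ hp] at hk2
  have e : l k - l 0 = k * (l 1 - l 0) := by linarith [(hk k).1]
  have e2 : |l k - l 0| ≤ 1 := by
    rw [abs_le]; constructor <;> linarith [h0 k, h1 k, h0 0, h1 0]
  rw [e, abs_mul, Nat.abs_cast] at e2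
  linarith

lemma Fr_tendsto {ρ : ℝ} (hρ : ρ ∈ Set.Ioo (0 : ℝ) 1) :
    Tendsto (fun n => Fr ρ n 0) atTop (nhds 0) := by
  have anti : ∀ x, Antitone (fun n => Fr ρ n x) := fun x => antitone_nat_of_succ_le
    fun n => Fr_anti hρ n x
  have hex : ∀ x, ∃ l, Tendsto (fun n => Fr ρ n x) atTop (nhds l) := fun x =>
    ⟨_, tendsto_atTop_ciInf (anti x) ⟨0, by rintro _ ⟨n, rfl⟩; exact Fr_nonneg hρ n x⟩⟩
  choose l hl using hex
  have h0 : ∀ x, 0 ≤ l x := fun x => ge_of_tendsto' (hl x) fun n => Fr_nonneg hρ n x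
  have h1 : ∀ x, l x ≤ 1 := fun x => le_of_tendsto' (hl x) fun n => by
    simpa [Fr] using anti x (Nat.zero_le n)
  have hrec : ∀ x, l x = (if x = 0 then 1 - ρ else 1) * ((l (x-1) + l (x+1)) / 2) := by
    intro x
    have a := (hl x).comp (tendsto_add_atTop_nat 1)
    have b : Tendsto (fun n => Fr ρ (n+1) x) atTop
        (nhds ((if x = 0 then 1 - ρ else 1) * ((l (x-1) + l (x+1)) / 2))) := by
      simp only [Fr]
      exact (((hl (x-1)).add (hl (x+1))).div_const 2).const_mul _
    exact tendsto_nhds_unique a b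
  have p1 : l 1 = l 0 := by
    have := bounded_affine (l := fun k : ℕ => l k) (fun k => h0 _) (fun k => h1 _) (by
      intro k
      have := hrec ((k:ℤ) + 1)
      rw [if_neg (by omega), one_mul] at this
      push_cast
      rw [this]
      (congr 3; ring_nf))
    simpa using this
  have p2 : l (-1) = l 0 := by
    have := bounded_affine (l := fun k : ℕ => l (-(k:ℤ))) (fun k => h0 _) (fun k => h1 _) (by
      intro k
      have := hrec (-((k:ℤ) + 1))
      rw [if_neg (by omega), one_mul] at this
      push_cast
      rw [this, add_comm]
      (congr 3; ring_nf))
    simpa using this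
  have := hrec 0
  simp only [if_true, zero_sub, zero_add, p1, p2] at this
  have h3 : ρ * l 0 = 0 := by linarith
  have h4 : l 0 = 0 := by
    rcases mul_eq_zero.mp h3 with h | h
    · exact absurd h hρ.1.ne'
    · exact h
  rw [← h4]
  exact hl 0

/-- Main estimate on the number of visited sites never visited at refreshed steps. -/
lemma unrefreshed_le {ρ : ℝ} (hρ : ρ ∈ Set.Ioo (0 : ℝ) 1) {ε : ℝ} (hε : 0 ≤ ε) (M : ℕ)
    (hM : ∀ n, M < n → Fr ρ n 0 ≤ ε) (n : ℕ) (A : Finset ℤ) :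
    Ex (wC ρ) n (fun c => (((Rs n c \ Vs n c) \ A).card : ℝ)) ≤
      ε * Ex (wC ρ) n (fun c => ((Rs n c \ A).card : ℝ)) + (M + 1) := by
  have hw : ∀ c, 0 ≤ wC ρ c := fun c => (wC_pos hρ c).le
  induction n generalizing A with
  | zero =>
    have : ((((Rs 0 Fin.elim0 \ Vs 0 Fin.elim0) \ A).card : ℕ) : ℝ) ≤ 1 := by
      have := Finset.card_le_card (Finset.sdiff_subset (s := Rs 0 Fin.elim0 \ Vs 0 Fin.elim0) (t := A))
      have h2 := Finset.card_le_card (Finset.sdiff_subset (s := Rs 0 Fin.elim0) (t := Vs 0 Fin.elim0))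
      have h3 := Rs_card_le 0 Fin.elim0
      exact_mod_cast this.trans (h2.trans h3)
    rw [Ex_zero, Ex_zero]
    have : 0 ≤ ε * (((Rs 0 Fin.elim0 \ A).card : ℕ) : ℝ) := by positivity
    have : (0:ℝ) ≤ M := by positivity
    linarith
  | succ n ih =>
    by_cases hn : n + 1 ≤ M
    · have h1 : Ex (wC ρ) (n+1) (fun c => (((Rs (n+1) c \ Vs (n+1) c) \ A).card : ℝ)) ≤ M + 1 := by
        rw [← Ex_const (wC_sum ρ) (n+1) ((M:ℝ)+1)]
        refine Ex_mono hw _ fun c => ?_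
        have := Finset.card_le_card (Finset.sdiff_subset (s := Rs (n+1) c \ Vs (n+1) c) (t := A))
        have h2 := Finset.card_le_card (Finset.sdiff_subset (s := Rs (n+1) c) (t := Vs (n+1) c))
        have h3 := Rs_card_le (n+1) c
        have h4 : ((Rs (n+1) c \ Vs (n+1) c) \ A).card ≤ M + 1 := by omega
        exact_mod_cast h4
      have h2 : 0 ≤ Ex (wC ρ) (n+1) (fun c => ((Rs (n+1) c \ A).card : ℝ)) := by
        rw [← Ex_const (wC_sum ρ) (n+1) 0]
        exact Ex_mono hw _ fun c => by positivity
      have := mul_nonneg hε h2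
      linarith
    · have hF := hM (n+1) (by omega)
      set A' : Ctl → Finset ℤ := fun a => (insert 0 A).image (· - sg a.2.1) with hA'
      have key1 : ∀ (c : Fin (n+1) → Ctl),
          (((Rs (n+1) c \ Vs (n+1) c) \ A).card : ℝ) ≤
          (if 0 ∈ A then 0 else 1) * (if 0 ∈ Vs (n+1) c then 0 else 1) +
          (((Rs n (Fin.tail c) \ Vs n (Fin.tail c)) \ A' (c 0)).card : ℝ) := by
        intro c
        have sub : (Rs (n+1) c \ Vs (n+1) c) \ A ⊆
            (if 0 ∈ A then ∅ else if 0 ∈ Vs (n+1) c then ∅ else {0}) ∪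
            ((Rs n (Fin.tail c) \ Vs n (Fin.tail c)) \ A' (c 0)).image (· + sg (c 0).2.1) := by
          intro z hz
          simp only [Finset.mem_sdiff] at hz
          obtain ⟨⟨z1, z2⟩, z3⟩ := hz
          by_cases hz0 : z = 0
          · subst hz0
            simp [z2, z3]
          · refine Finset.mem_union_right _ ?_
            simp only [Rs, Finset.mem_insert, hz0, false_or, Finset.mem_image] at z1
            obtain ⟨y, hy, rfl⟩ := z1
            refine Finset.mem_image.mpr ⟨y, ?_, rfl⟩
            simp only [Finset.mem_sdiff]
            refine ⟨⟨hy, fun hv => z2 ?_⟩, fun ha => ?_⟩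
            · simp only [Vs]
              exact Finset.mem_union_right _ (Finset.mem_image.mpr ⟨y, hv, rfl⟩)
            · simp only [hA', Finset.mem_image, Finset.mem_insert] at ha
              obtain ⟨u, hu, rfl⟩ := ha
              simp only [sub_add_cancel] at hz0 z3
              tauto
        have := (Finset.card_le_card sub).trans ((Finset.card_union_le _ _).trans
          (Nat.add_le_add_left Finset.card_image_le _))
        have h5 : ((if 0 ∈ A then ∅ else if 0 ∈ Vs (n+1) c then ∅ else {0} : Finset ℤ).card : ℝ)
          = (if 0 ∈ A then 0 else 1) * (if 0 ∈ Vs (n+1) c then 0 else 1) := by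
          split_ifs <;> simp
        rw [← h5]
        exact_mod_cast this
      have key2 : ∀ (c : Fin (n+1) → Ctl),
          (if 0 ∈ A then 0 else 1) + ((Rs n (Fin.tail c) \ A' (c 0)).card : ℝ) ≤
          ((Rs (n+1) c \ A).card : ℝ) := by
        intro c
        have sub : (if 0 ∈ A then ∅ else {0}) ∪
            (Rs n (Fin.tail c) \ A' (c 0)).image (· + sg (c 0).2.1) ⊆ Rs (n+1) c \ A := by
          intro z hz
          rw [Finset.mem_union] at hz
          rcases hz with hz | hz
          · split_ifs at hz with h0
            · simp at hz
            · simp only [Finset.mem_singleton] at hz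
              subst hz
              simp [Rs, h0]
          · obtain ⟨y, hy, rfl⟩ := Finset.mem_image.mp hz
            simp only [Finset.mem_sdiff] at hy ⊢
            refine ⟨Finset.mem_insert_of_mem (Finset.mem_image.mpr ⟨y, hy.1, rfl⟩), fun ha => hy.2 ?_⟩
            exact Finset.mem_image.mpr ⟨y + sg (c 0).2.1, Finset.mem_insert_of_mem ha, by ring⟩
        have hd : Disjoint (if 0 ∈ A then ∅ else {0} : Finset ℤ)
            ((Rs n (Fin.tail c) \ A' (c 0)).image (· + sg (c 0).2.1)) := by
          split_ifs with h0
          · simp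
          · rw [Finset.disjoint_singleton_left]
            intro hz
            obtain ⟨y, hy, h0⟩ := Finset.mem_image.mp hz
            simp only [Finset.mem_sdiff] at hy
            exact hy.2 (Finset.mem_image.mpr ⟨0, Finset.mem_insert_self _ _, by linarith⟩)
        have := Finset.card_le_card sub
        rw [Finset.card_union_of_disjoint hd, Finset.card_image_of_injective _
          (add_left_injective _)] at this
        have h5 : ((if 0 ∈ A then ∅ else {0} : Finset ℤ).card : ℝ)
          = (if 0 ∈ A then 0 else 1) := by
          split_ifs <;> simp
        rw [← h5]
        exact_mod_cast this
      set α : ℝ := if 0 ∈ A then 0 else 1 with hα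
      have hα0 : 0 ≤ α := by rw [hα]; split_ifs <;> norm_num
      have b1 := Ex_mono hw (n+1) key1
      have b2 := Ex_mono hw (n+1) key2
      rw [Ex_add, Ex_mul, Fr_eq] at b1
      rw [Ex_add, Ex_const (wC_sum ρ)] at b2
      have b3 : Ex (wC ρ) (n+1) (fun c => (((Rs n (Fin.tail c) \ Vs n (Fin.tail c)) \ A' (c 0)).card : ℝ))
          ≤ ε * Ex (wC ρ) (n+1) (fun c => ((Rs n (Fin.tail c) \ A' (c 0)).card : ℝ)) + (M + 1) := by
        rw [Ex_succ, Ex_succ, Finset.mul_sum]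
        simp only [Fin.tail_cons, Fin.cons_zero]
        have e : ((M:ℝ)+1) = ∑ a, wC ρ a * (M+1) := by rw [← Finset.sum_mul, wC_sum, one_mul]
        rw [e, ← Finset.sum_add_distrib]
        refine Finset.sum_le_sum fun a _ => ?_
        refine (mul_le_mul_of_nonneg_left (ih (A' a)) (hw a)).trans (le_of_eq ?_)
        ring
      have b4 := mul_le_mul_of_nonneg_left hF hα0
      have b5 := mul_le_mul_of_nonneg_left b2 hε
      linarith

lemma Ex_sq (ρ : ℝ) (n : ℕ) : Ex (wC ρ) n (fun c => (Ts n c : ℝ)^2) = n := by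
  induction n with
  | zero => simp [Ex_zero, Ts]
  | succ n ih =>
    have h : ∀ (s : ℝ), Ex (wC ρ) n (fun c => (s + (Ts n c : ℝ))^2) =
        s^2 + 2 * s * Ex (wC ρ) n (fun c => (Ts n c : ℝ)) + n := by
      intro s
      rw [← ih, ← Ex_const (wC_sum ρ) n (s^2), ← Ex_mul, ← Ex_add, ← Ex_add]
      congr 1; funext c; ring
    rw [Ex_succ]
    simp only [Ts, Fin.cons_zero, Fin.tail_cons, Int.cast_add, h]
    simp [Fintype.sum_prod_type, wC, sg]
    ring

lemma Ex_four (ρ : ℝ) (n : ℕ) : Ex (wC ρ) n (fun c => (Ts n c : ℝ)^4) = 3 * (n:ℝ)^2 - 2 * n := by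
  induction n with
  | zero => simp [Ex_zero, Ts]
  | succ n ih =>
    have h : ∀ (s : ℝ), Ex (wC ρ) n (fun c => (s + (Ts n c : ℝ))^4) =
        s^4 + 4 * s^3 * Ex (wC ρ) n (fun c => (Ts n c : ℝ)) + 6 * s^2 * n +
        4 * s * Ex (wC ρ) n (fun c => (Ts n c : ℝ)^3) + (3 * (n:ℝ)^2 - 2 * n) := by
      intro s
      rw [← ih, ← Ex_const (wC_sum ρ) n (s^4), ← Ex_sq ρ n, ← Ex_mul, ← Ex_mul, ← Ex_mul,
        ← Ex_add, ← Ex_add, ← Ex_add, ← Ex_add]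
      congr 1; funext c; ring
    rw [Ex_succ]
    simp only [Ts, Fin.cons_zero, Fin.tail_cons, Int.cast_add, h]
    simp [Fintype.sum_prod_type, wC, sg]
    ring

lemma range_lower {ρ : ℝ} (hρ : ρ ∈ Set.Ioo (0 : ℝ) 1) (n : ℕ) :
    Real.sqrt n / 8 ≤ Ex (wC ρ) n (fun c => ((Rs n c).card : ℝ)) := by
  have hw : ∀ c, 0 ≤ wC ρ c := fun c => (wC_pos hρ c).le
  rcases Nat.eq_zero_or_pos n with rfl | hn
  · simp [Ex_zero]
  have hs : 0 < Real.sqrt n := Real.sqrt_pos.mpr (by exact_mod_cast hn)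
  have hss : Real.sqrt n ^ 2 = n := Real.sq_sqrt (by positivity)
  set r := Real.sqrt n with hr
  have key : ∀ c : Fin n → Ctl, (1 / (2 * r)) * (Ts n c : ℝ)^2 + (-(1 / (8 * r^3))) * (Ts n c : ℝ)^4
      ≤ ((Rs n c).card : ℝ) := by
    intro c
    have h1 : |(Ts n c : ℝ)| ≤ ((Rs n c).card : ℝ) := by exact_mod_cast abs_Ts_le n c
    refine le_trans ?_ h1
    set t := |(Ts n c : ℝ)| with ht
    have ht0 : 0 ≤ t := abs_nonneg _
    have e2 : (Ts n c : ℝ)^2 = t^2 := (sq_abs _).symm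
    have e4 : (Ts n c : ℝ)^4 = t^4 := by
      rw [show (Ts n c : ℝ)^4 = ((Ts n c : ℝ)^2)^2 by ring, e2]; ring
    rw [e2, e4]
    set u := t / (2 * r) with hu
    have htu : t = 2 * r * u := by rw [hu]; field_simp
    have hu0 : 0 ≤ u := by positivity
    have : (1 / (2 * r)) * t^2 + (-(1 / (8 * r^3))) * t^4 = 2 * r * (u^2 - u^4) := by
      rw [htu]; field_simp
      ring
    rw [this, htu]
    refine mul_le_mul_of_nonneg_left ?_ (by positivity)
    rcases le_total u 1 with h | h
    · nlinarith [pow_nonneg hu0 4]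
    · nlinarith [pow_le_pow_right₀ h (show 2 ≤ 4 by norm_num)]
  have := Ex_mono hw n key
  rw [Ex_add, Ex_mul, Ex_mul, Ex_sq, Ex_four] at this
  refine le_trans ?_ this
  rw [← hss]
  have : 1 / (2 * r) * r^2 + -(1 / (8 * r^3)) * (3 * (r^2)^2 - 2 * r^2) = r / 8 + 1 / (4 * r) := by
    field_simp; ring
  rw [this]
  have : 0 ≤ 1 / (4 * r) := by positivity
  linarith

/-- one step: direction and two switches -/
abbrev Stp := Bool × ZMod 2 × ZMod 2

/-- group element of a step -/
noncomputable def gst (s : Stp) : Lamplighter :=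
  ⟨Multiplicative.ofAdd (Finsupp.single 0 s.2.1 + Finsupp.single (sg s.1) s.2.2),
    Multiplicative.ofAdd (-(sg s.1))⟩

lemma lampShiftAux_single (t z : ℤ) (a : ZMod 2) :
    lampShiftAux t (Finsupp.single z a) = Finsupp.single (z - t) a := by
  simp [lampShiftAux, Finsupp.domCongr_apply]

lemma lampShiftAux_apply (t z : ℤ) (f : LampConf) : lampShiftAux t f z = f (z + t) := by
  simp [lampShiftAux, Finsupp.domCongr_apply]

lemma left_mul' (g h : Lamplighter) : (g * h).left =
    Multiplicative.ofAdd (g.left.toAdd + lampShiftAux g.right.toAdd h.left.toAdd) := rfl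

lemma muSwitch_eq : muSwitch = push (fun _ : ZMod 2 => (1:ℝ)/2)
    (fun a => (⟨Multiplicative.ofAdd (Finsupp.single 0 a), 1⟩ : Lamplighter)) := by
  classical
  funext g
  simp only [muSwitch, push, Set.indicator, Set.mem_singleton_iff]
  rw [show (Finset.univ : Finset (ZMod 2)) = {0, 1} from rfl, Finset.sum_pair (by decide)]
  congr 1
  · refine if_congr ?_ rfl rfl
    simp only [Finsupp.single_zero]
    exact eq_comm
  · refine if_congr ?_ rfl rfl
    exact eq_comm

lemma muWalk_eq : muWalk = push (fun _ : Bool => (1:ℝ)/2)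
    (fun e => (⟨1, Multiplicative.ofAdd (-(sg e))⟩ : Lamplighter)) := by
  classical
  funext g
  simp only [muWalk, push, Set.indicator, Set.mem_singleton_iff, Fintype.sum_bool]
  rw [add_comm]
  congr 1
  · refine if_congr ?_ rfl rfl
    exact eq_comm
  · refine if_congr ?_ rfl rfl
    exact eq_comm

lemma muSWS_eq : muSWS = push (fun _ : Stp => (1:ℝ)/8) gst := by
  rw [muSWS, muSwitch_eq, muWalk_eq, conv_push, conv_push]
  refine push_equiv (⟨fun x => (x.2.1, x.1, x.2.2), fun x => (x.2.1, x.1, x.2.2),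
    fun _ => rfl, fun _ => rfl⟩ : ZMod 2 × Bool × ZMod 2 ≃ Stp) _ _ _ _ ?_ ?_
  · intro x; norm_num
  · rintro ⟨a, e, b⟩
    simp only [Equiv.coe_fn_mk]
    apply SemidirectProduct.ext
    · simp only [left_mul', gst]
      simp only [toAdd_ofAdd, toAdd_one, zero_add, lampShiftAux_single, zero_sub, neg_neg,
        sub_zero]
    · simp [gst]

/-- bits -/
abbrev Bits := ZMod 2 × ZMod 2 × ZMod 2 × ZMod 2

/-- weight of full symbols -/
noncomputable def wO (ρ : ℝ) (x : Ctl × Bits) : ℝ := wC ρ x.1 * 16⁻¹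

/-- step of first walk -/
def stX (x : Ctl × Bits) : Stp := (x.1.2.1, x.2.1, x.2.2.1)
/-- step of second walk -/
def stY (x : Ctl × Bits) : Stp :=
  if x.1.1 then (x.1.2.2, x.2.2.2.1, x.2.2.2.2) else (x.1.2.1, x.2.1, x.2.2.1)

/-- reorder -/
def reord : Ctl × Bits ≃ Bool × Stp × Stp :=
  ⟨fun x => (x.1.1, (x.1.2.1, x.2.1, x.2.2.1), (x.1.2.2, x.2.2.2.1, x.2.2.2.2)),
   fun y => ((y.1, y.2.1.1, y.2.2.1), (y.2.1.2.1, y.2.1.2.2, y.2.2.2.1, y.2.2.2.2)),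
   fun _ => rfl, fun _ => rfl⟩

lemma push_reord {G : Type*} (ρ : ℝ) (F : Stp → Stp → G) (K : Ctl × Bits → G)
    (h : ∀ x, K x = if (reord x).1 then F (reord x).2.1 (reord x).2.2 else
      F (reord x).2.1 (reord x).2.1) :
    push (wO ρ) K = fun g => open Classical in
      ρ / 64 * (∑ s, ∑ s', if F s s' = g then 1 else 0) +
      (1 - ρ) / 8 * (∑ s, if F s s = g then 1 else 0) := by
  classical
  have := push_equiv reord (wO ρ) K
    (fun y : Bool × Stp × Stp => (if y.1 then ρ else 1 - ρ) / 64)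
    (fun y => if y.1 then F y.2.1 y.2.2 else F y.2.1 y.2.1)
    (by
      rintro ⟨⟨r, e, e'⟩, b⟩
      cases r <;> simp [wO, wC, reord] <;> ring) (fun x => (h x).symm)
  rw [this]
  funext g
  simp only [push]
  rw [Fintype.sum_prod_type]
  simp only [Fintype.sum_bool, if_true]
  congr 1
  · rw [Fintype.sum_prod_type, Finset.mul_sum]
    refine Finset.sum_congr rfl fun s _ => ?_
    rw [Finset.mul_sum]
    simp
  · rw [Fintype.sum_prod_type, Finset.mul_sum]
    refine Finset.sum_congr rfl fun s _ => ?_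
    simp only [Bool.false_eq_true, if_false, Finset.sum_const, Finset.card_univ]
    simp only [Fintype.card_prod, Fintype.card_bool, ZMod.card]
    split_ifs <;> simp
    ring

lemma card_Stp : Fintype.card Stp = 8 := by
  simp [Fintype.card_prod]

lemma mu_eq_X (ρ : ℝ) : muSWS = push (wO ρ) (fun x => gst (stX x)) := by
  classical
  rw [push_reord ρ (fun s _ => gst s) _ (by intro x; simp [reord, stX]), muSWS_eq]
  funext g
  simp only [push, Finset.sum_const, Finset.card_univ, card_Stp]
  rw [← Finset.smul_sum, nsmul_eq_mul]
  have : (∑ x, if gst x = g then (1:ℝ)/8 else 0) = 1/8 * ∑ x, if gst x = g then (1:ℝ) else 0 := by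
    rw [Finset.mul_sum]; simp
  rw [this]
  push_cast
  ring

lemma mu_eq_Y (ρ : ℝ) : muSWS = push (wO ρ) (fun x => gst (stY x)) := by
  classical
  rw [push_reord ρ (fun _ s => gst s) _ (by
    rintro ⟨⟨r, e, e'⟩, b⟩; cases r <;> simp [reord, stY]), muSWS_eq]
  funext g
  simp only [push, Finset.sum_const, Finset.card_univ, card_Stp]
  rw [nsmul_eq_mul]
  have : (∑ x, if gst x = g then (1:ℝ)/8 else 0) = 1/8 * ∑ x, if gst x = g then (1:ℝ) else 0 := by
    rw [Finset.mul_sum]; simp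
  rw [this]
  push_cast
  ring

lemma noise_eq (ρ : ℝ) : noise muSWS ρ = push (wO ρ) (fun x => (gst (stX x), gst (stY x))) := by
  classical
  rw [push_reord ρ (fun s s' => (gst s, gst s')) _ (by
    rintro ⟨⟨r, e, e'⟩, b⟩; cases r <;> simp [reord, stX, stY]), muSWS_eq]
  funext p
  simp only [noise, diagM, prodM, push]
  rw [add_comm]
  have : ∀ g, (∑ x, if gst x = g then (1:ℝ)/8 else 0) = 1/8 * ∑ x, if gst x = g then (1:ℝ) else 0 := by
    intro g; rw [Finset.mul_sum]; simp
  congr 1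
  · rw [this, this]
    trans ρ / 64 * ((∑ s, if gst s = p.1 then (1:ℝ) else 0) *
      (∑ s, if gst s = p.2 then (1:ℝ) else 0))
    · ring
    · congr 1
      rw [Finset.sum_mul_sum]
      refine Finset.sum_congr rfl fun s _ => Finset.sum_congr rfl fun s' _ => ?_
      rw [ite_zero_mul_ite_zero, mul_one]
      by_cases h : (gst s, gst s') = p
      · rw [if_pos h, if_pos ⟨by rw [← h], by rw [← h]⟩]
      · rw [if_neg h, if_neg fun h2 => h (Prod.ext h2.1 h2.2)]
  · simp only [Set.indicator, Set.mem_ofPred_eq]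
    by_cases h : p.1 = p.2
    · rw [if_pos h, this]
      have : ∀ s, ((gst s, gst s) = p) ↔ gst s = p.1 := by
        intro s; rw [Prod.ext_iff]; simp [← h]
      simp only [this]
      ring
    · rw [if_neg h]
      have : ∀ s, ¬ ((gst s, gst s) = p) := by
        rintro s rfl; exact h rfl
      simp [this]

/-- swap the two directions at refreshed steps -/
def swp (c : Ctl) : Ctl := if c.1 then (c.1, c.2.2, c.2.1) else c

lemma swp_swp (c : Ctl) : swp (swp c) = c := by
  revert c; decide

lemma swp_fst (c : Ctl) : (swp c).1 = c.1 := by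
  revert c; decide

lemma Ex_swp (ρ : ℝ) (n : ℕ) (F : (Fin n → Ctl) → ℝ) :
    Ex (wC ρ) n (fun c => F (fun i => swp (c i))) = Ex (wC ρ) n F := by
  let e : (Fin n → Ctl) ≃ (Fin n → Ctl) := ⟨fun c i => swp (c i), fun c i => swp (c i),
    fun c => by simp [swp_swp], fun c => by simp [swp_swp]⟩
  unfold Ex
  rw [← e.sum_comp (fun c => (∏ i, wC ρ (c i)) * F c)]
  refine Finset.sum_congr rfl fun c _ => ?_
  congr 1
  refine Finset.prod_congr rfl fun i _ => ?_
  simp [e, wC, swp_fst]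

/-- lamps of first walk -/
noncomputable def fX : (n : ℕ) → (Fin n → Ctl) → (Fin n → Bits) → LampConf
  | 0, _, _ => 0
  | n + 1, c, d => Finsupp.single 0 (d 0).1 + Finsupp.single (sg (c 0).2.1) (d 0).2.1 +
      lampShiftAux (-(sg (c 0).2.1)) (fX n (Fin.tail c) (Fin.tail d))

/-- lamps of second walk -/
noncomputable def fY : (n : ℕ) → (Fin n → Ctl) → (Fin n → Bits) → LampConf
  | 0, _, _ => 0
  | n + 1, c, d => Finsupp.single 0 (if (c 0).1 then (d 0).2.2.1 else (d 0).1) +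
      Finsupp.single (sg (swp (c 0)).2.1) (if (c 0).1 then (d 0).2.2.2 else (d 0).2.1) +
      lampShiftAux (-(sg (swp (c 0)).2.1)) (fY n (Fin.tail c) (Fin.tail d))

lemma PP_X (n : ℕ) (x : Fin n → Ctl × Bits) : PP (fun x => gst (stX x)) n x =
    ⟨Multiplicative.ofAdd (fX n (fun i => (x i).1) (fun i => (x i).2)),
      Multiplicative.ofAdd (-(Ts n (fun i => (x i).1)))⟩ := by
  induction n with
  | zero => rfl
  | succ n ih =>
    rw [PP, ih]
    apply SemidirectProduct.ext
    · rw [left_mul']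
      rfl
    · rw [SemidirectProduct.mul_right]
      simp only [Ts, gst, stX]
      rw [← ofAdd_add, neg_add]
      rfl

lemma PP_Y_left (n : ℕ) (x : Fin n → Ctl × Bits) : (PP (fun x => gst (stY x)) n x).left =
    Multiplicative.ofAdd (fY n (fun i => (x i).1) (fun i => (x i).2)) := by
  induction n with
  | zero => rfl
  | succ n ih =>
    rw [PP, left_mul', ih]
    simp only [fY, gst, stY, swp]
    cases h : (x 0).1.1 <;> simp <;> rfl

lemma PP_pair {Ω G : Type*} [Group G] (φ ψ : Ω → G) (n : ℕ) (x : Fin n → Ω) :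
    PP (fun x => (φ x, ψ x)) n x = (PP φ n x, PP ψ n x) := by
  induction n with
  | zero => rfl
  | succ n ih => rw [PP, ih]; rfl

lemma fX_supp (n : ℕ) (c : Fin n → Ctl) (d : Fin n → Bits) : ∀ z, fX n c d z ≠ 0 → z ∈ Rs n c := by
  induction n with
  | zero => intro z; simp [fX]
  | succ n ih =>
    intro z hz
    by_contra hz2
    simp only [Rs, Finset.mem_insert, Finset.mem_image, not_or, not_exists, not_and] at hz2
    obtain ⟨h0, h1⟩ := hz2
    have h2 : z ≠ sg (c 0).2.1 := by
      intro h
      obtain ⟨lo, hi, h5, h6⟩ := Rs_spec n (Fin.tail c)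
      refine h1 0 ?_ (by simp [h])
      rw [h5, Finset.mem_Icc]; omega
    apply hz
    simp only [fX, Finsupp.add_apply, lampShiftAux_apply]
    rw [Finsupp.single_eq_of_ne h0, Finsupp.single_eq_of_ne h2]
    by_contra h3
    simp only [zero_add] at h3
    exact h1 _ (ih _ _ _ h3) (by ring)

lemma fX_add (n : ℕ) (c : Fin n → Ctl) (d d' : Fin n → Bits) :
    fX n c (d + d') = fX n c d + fX n c d' := by
  induction n with
  | zero => simp [fX]
  | succ n ih =>
    have : Fin.tail (d + d') = Fin.tail d + Fin.tail d' := rfl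
    simp only [fX, this, ih, map_add, Pi.add_apply, Prod.fst_add, Prod.snd_add, Finsupp.single_add]
    abel

lemma fY_add (n : ℕ) (c : Fin n → Ctl) (d d' : Fin n → Bits) :
    fY n c (d + d') = fY n c d + fY n c d' := by
  induction n with
  | zero => simp [fY]
  | succ n ih =>
    have : Fin.tail (d + d') = Fin.tail d + Fin.tail d' := rfl
    simp only [fY, this, ih, map_add, Pi.add_apply, Prod.fst_add, Prod.snd_add]
    split_ifs <;> simp only [Finsupp.single_add] <;> abel

/-- lamps as a homomorphism of the bits -/
noncomputable def Zh (n : ℕ) (c : Fin n → Ctl) : (Fin n → Bits) →+ LampConf × LampConf :=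
  AddMonoidHom.mk' (fun d => (fX n c d, fY n c d)) fun d d' => by
    rw [fX_add, fY_add]; rfl

lemma Zh_apply (n : ℕ) (c : Fin n → Ctl) (d) : Zh n c d = (fX n c d, fY n c d) := rfl

lemma Zh_cons (n : ℕ) (c : Fin (n+1) → Ctl) (d : Fin n → Bits) (b : Bits) :
    Zh (n+1) c (Fin.cons b d : Fin (n+1) → Bits) =
     (Finsupp.single 0 b.1 + Finsupp.single (sg (c 0).2.1) b.2.1 +
      lampShiftAux (-(sg (c 0).2.1)) (Zh n (Fin.tail c) d).1,
      Finsupp.single 0 (if (c 0).1 then b.2.2.1 else b.1) +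
      Finsupp.single (sg (swp (c 0)).2.1) (if (c 0).1 then b.2.2.2 else b.2.1) +
      lampShiftAux (-(sg (swp (c 0)).2.1)) (Zh n (Fin.tail c) d).2) := rfl

lemma Zh_rangeX (n : ℕ) (c : Fin n → Ctl) (z : ℤ) (hz : z ∈ Vs n c) :
    ((Finsupp.single z 1, 0) : LampConf × LampConf) ∈ (Zh n c).range := by
  induction n generalizing z with
  | zero => simp [Vs] at hz
  | succ n ih =>
    rw [Vs, Finset.mem_union] at hz
    rcases hz with hz | hz
    · split_ifs at hz with h
      · simp only [Finset.mem_singleton] at hz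
        subst hz
        refine ⟨Fin.cons (1, 0, 0, 0) 0, ?_⟩
        rw [Zh_cons, map_zero]
        simp [h]
      · simp at hz
    · obtain ⟨y, hy, rfl⟩ := Finset.mem_image.mp hz
      obtain ⟨d, hd⟩ := ih _ y hy
      refine ⟨Fin.cons 0 d, ?_⟩
      rw [Zh_cons, hd]
      simp [lampShiftAux_single]

lemma Zh_rangeY (n : ℕ) (c : Fin n → Ctl) (z : ℤ) (hz : z ∈ Vs n (fun i => swp (c i))) :
    ((0, Finsupp.single z 1) : LampConf × LampConf) ∈ (Zh n c).range := by
  induction n generalizing z with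
  | zero => simp [Vs] at hz
  | succ n ih =>
    rw [Vs, Finset.mem_union] at hz
    rcases hz with hz | hz
    · split_ifs at hz with h
      · simp only [Finset.mem_singleton] at hz
        rw [swp_fst] at h
        subst hz
        refine ⟨Fin.cons (0, 0, 1, 0) 0, ?_⟩
        rw [Zh_cons, map_zero]
        simp [h]
      · simp at hz
    · obtain ⟨y, hy, rfl⟩ := Finset.mem_image.mp hz
      obtain ⟨d, hd⟩ := ih (Fin.tail c) y hy
      refine ⟨Fin.cons 0 d, ?_⟩
      rw [Zh_cons, hd]
      simp [lampShiftAux_single]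

/-- indicator configuration -/
noncomputable def indc (A : Finset ℤ) : LampConf := ∑ z ∈ A, Finsupp.single z 1

lemma indc_inj : Function.Injective indc := by
  intro A B h
  have : ∀ (A : Finset ℤ) z, indc A z = if z ∈ A then 1 else 0 := by
    intro A z
    simp [indc, Finsupp.finsetSum_apply, Finsupp.single_apply]
  ext z
  have h2 : indc A z = indc B z := by rw [h]
  rw [this, this] at h2
  by_cases hA : z ∈ A <;> by_cases hB : z ∈ B <;> simp_all

lemma fiber_bound (n : ℕ) (c : Fin n → Ctl) (y : LampConf × LampConf) :
    (open Classical in (Finset.univ.filter fun d => Zh n c d = y).card) *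
      2 ^ ((Vs n c).card + (Vs n (fun i => swp (c i))).card) ≤ Fintype.card (Fin n → Bits) := by
  classical
  set VX := Vs n c
  set VY := Vs n (fun i => swp (c i))
  by_cases hy : y ∈ (Zh n c).range
  · obtain ⟨d0, rfl⟩ := hy
    set P := VX.powerset ×ˢ VY.powerset with hP
    set Q : Finset (LampConf × LampConf) := P.image (fun p => (indc p.1, indc p.2)) with hQ
    have hQc : Q.card = 2 ^ (VX.card + VY.card) := by
      rw [hQ, Finset.card_image_of_injective, hP, Finset.card_product, Finset.card_powerset,
        Finset.card_powerset, pow_add]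
      exact indc_inj.prodMap indc_inj
    have hQr : ∀ q ∈ Q, q ∈ (Zh n c).range := by
      intro q hq
      obtain ⟨⟨A, B⟩, hAB, rfl⟩ := Finset.mem_image.mp hq
      simp only [hP, Finset.mem_product, Finset.mem_powerset] at hAB
      have e : ((indc A, indc B) : LampConf × LampConf) =
        ∑ z ∈ A, ((Finsupp.single z 1, 0) : LampConf × LampConf) +
        ∑ z ∈ B, ((0, Finsupp.single z 1) : LampConf × LampConf) := by
        apply Prod.ext <;> simp [indc, Prod.fst_sum, Prod.snd_sum]
      show ((indc A, indc B) : LampConf × LampConf) ∈ _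
      rw [e]
      exact add_mem (sum_mem fun z hz => Zh_rangeX n c z (hAB.1 hz))
        (sum_mem fun z hz => Zh_rangeY n c z (hAB.2 hz))
    have hf : ∀ q ∈ Q, (Finset.univ.filter fun d => Zh n c d = q).card =
        (Finset.univ.filter fun d => Zh n c d = Zh n c d0).card := by
      intro q hq
      obtain ⟨d1, rfl⟩ := hQr q hq
      refine Finset.card_bij (fun d _ => d - d1 + d0) ?_ ?_ ?_
      · intro d hd
        simp only [Finset.mem_filter, Finset.mem_univ, true_and] at hd ⊢
        simp [hd]
      · intro d _ d' _ h
        simpa using h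
      · intro d hd
        simp only [Finset.mem_filter, Finset.mem_univ, true_and] at hd
        refine ⟨d - d0 + d1, ?_, by abel⟩
        simp [hd]
    calc _ = ∑ q ∈ Q, (Finset.univ.filter fun d => Zh n c d = q).card := by
          rw [Finset.sum_congr rfl hf, Finset.sum_const, hQc, smul_eq_mul, mul_comm]
      _ = (Finset.univ.filter fun d => Zh n c d ∈ Q).card := by
          rw [Finset.card_eq_sum_card_fiberwise (f := fun d => Zh n c d) (t := Q)]
          · refine Finset.sum_congr rfl fun q hq => ?_
            congr 1
            ext d
            simp only [Finset.mem_filter, Finset.mem_univ, true_and]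
            constructor
            · rintro rfl; exact ⟨hq, rfl⟩
            · exact fun h => h.2
          · intro d hd
            simpa using hd
      _ ≤ _ := Finset.card_le_univ _
  · rw [Finset.card_eq_zero.mpr]
    · simp
    · rw [Finset.filter_eq_empty_iff]
      rintro d _ rfl
      exact hy ⟨d, rfl⟩

lemma push_split {G : Type*} (ρ : ℝ) (n : ℕ) (Φ : (Fin n → Ctl × Bits) → G) :
    push (fun x : Fin n → Ctl × Bits => ∏ i, wO ρ (x i)) Φ =
    push (fun y : (Fin n → Ctl) × (Fin n → Bits) =>
      (∏ i, wC ρ (y.1 i)) * (Fintype.card (Fin n → Bits) : ℝ)⁻¹)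
      (fun y => Φ (fun i => (y.1 i, y.2 i))) := by
  refine push_equiv (Equiv.arrowProdEquivProdArrow (Fin n) (fun _ => Ctl) (fun _ => Bits)) _ _ _ _ ?_ ?_
  · intro x
    have : (Fintype.card (Fin n → Bits) : ℝ) = 16 ^ n := by
      rw [Fintype.card_fun, Fintype.card_fin]
      simp only [Fintype.card_prod, ZMod.card]
      norm_num
    simp only [wO, Finset.prod_mul_distrib, this]
    simp [Equiv.arrowProdEquivProdArrow]
  · intro x
    rfl

lemma sum_split (ρ : ℝ) (n : ℕ) (F : (Fin n → Ctl) → ℝ) :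
    ∑ x : Fin n → Ctl × Bits, (∏ i, wO ρ (x i)) * F (fun i => (x i).1) = Ex (wC ρ) n F := by
  have h := congrFun (push_split ρ n (fun x => (fun i => (x i).1))) 
  have h2 := tsum_push (fun x : Fin n → Ctl × Bits => ∏ i, wO ρ (x i))
    (fun x => (fun i => (x i).1)) F
  simp only [h] at h2
  rw [← h2, tsum_push, Fintype.sum_prod_type]
  unfold Ex
  refine Finset.sum_congr rfl fun c _ => ?_
  simp only
  rw [Finset.sum_const, Finset.card_univ, nsmul_eq_mul]
  have : (Fintype.card (Fin n → Bits) : ℝ) ≠ 0 := by exact_mod_cast Fintype.card_ne_zero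
  field_simp

lemma wO_pos {ρ : ℝ} (hρ : ρ ∈ Set.Ioo (0 : ℝ) 1) (x) : 0 < wO ρ x :=
  mul_pos (wC_pos hρ _) (by norm_num)

lemma sum_wO (ρ : ℝ) (n : ℕ) : ∑ x : Fin n → Ctl × Bits, (∏ i, wO ρ (x i)) = 1 := by
  have := sum_split ρ n (fun _ => 1)
  rw [Ex_const (wC_sum ρ)] at this
  simpa using this

lemma entropy_upper {ρ : ℝ} (hρ : ρ ∈ Set.Ioo (0 : ℝ) 1) (n : ℕ) :
    entropy (convPow muSWS n) ≤
      Real.log 2 * Ex (wC ρ) n (fun c => ((Rs n c).card : ℝ)) + 3 * Real.log (2 * n + 1) := by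
  classical
  rw [mu_eq_X ρ, convPow_push]
  set I : Finset ℤ := Finset.Icc (-(n:ℤ)) n with hI
  have hIc : (I.card : ℝ) = 2 * n + 1 := by
    rw [hI, Int.card_Icc]
    have : ((n:ℤ) + 1 - -(n:ℤ)).toNat = 2 * n + 1 := by omega
    rw [this]; push_cast; ring
  set J : Finset (ℤ × ℤ × ℤ) := I ×ˢ I ×ˢ I with hJ
  set K : ℝ := (2 * n + 1 : ℝ)^3 with hK
  have hK0 : 0 < K := by positivity
  have hJc : (J.card : ℝ) = K := by
    rw [hJ, Finset.card_product, Finset.card_product]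
    push_cast
    rw [hIc, hK]; ring
  let t : ℤ × ℤ × ℤ → Lamplighter → ℝ := fun j g =>
    if (g.left.toAdd.support ⊆ Finset.Icc j.1 j.2.1 ∧ g.right.toAdd = j.2.2) then
      K⁻¹ * (2 ^ (Finset.Icc j.1 j.2.1).card)⁻¹ else 0
  have ht0 : ∀ j g, 0 ≤ t j g := by
    intro j g
    simp only [t]
    split_ifs <;> positivity
  set q : Lamplighter → ℝ := fun g => ∑ j ∈ J, t j g with hq
  have hlow : ∀ x : Fin n → Ctl × Bits,
      K⁻¹ * (2 ^ (Rs n (fun i => (x i).1)).card)⁻¹ ≤ q (PP (fun x => gst (stX x)) n x) := by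
    intro x
    obtain ⟨lo, hi, h, h1, h2, h3, h4, h5, h6⟩ := Rs_spec n (fun i => (x i).1)
    have hj : (lo, hi, -(Ts n (fun i => (x i).1))) ∈ J := by
      simp only [hJ, hI, Finset.mem_product, Finset.mem_Icc]
      omega
    refine le_trans (le_of_eq ?_) (Finset.single_le_sum (fun j _ => ht0 j _) hj)
    simp only [t]
    rw [PP_X, if_pos, h]
    refine ⟨?_, rfl⟩
    intro z hz
    rw [← h]
    exact fX_supp n _ _ z (Finsupp.mem_support_iff.mp hz)
  have hq0 : ∀ x : Fin n → Ctl × Bits, 0 < q (PP (fun x => gst (stX x)) n x) := fun x =>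
    lt_of_lt_of_le (by positivity) (hlow x)
  have hg := gibbs (w := fun x : Fin n → Ctl × Bits => ∏ i, wO ρ (x i))
    (fun x => Finset.prod_pos fun i _ => wO_pos hρ _) (sum_wO ρ n)
    (PP (fun x => gst (stX x)) n) q hq0 (Finset.univ.image (PP (fun x => gst (stX x)) n))
    (by simp) (fun g => Finset.sum_nonneg fun j _ => ht0 j g) (by
      rw [hq, Finset.sum_comm]
      have : ∀ j ∈ J, ∑ g ∈ Finset.univ.image (PP (fun x => gst (stX x)) n), t j g ≤ K⁻¹ := by
        intro j _
        simp only [t]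
        rw [← Finset.sum_filter, Finset.sum_const, nsmul_eq_mul]
        set Q := Finset.filter (fun g : Lamplighter => g.left.toAdd.support ⊆ Finset.Icc j.1 j.2.1 ∧
          g.right.toAdd = j.2.2) (Finset.univ.image (PP (fun x => gst (stX x)) n)) with hQ
        have hc : Q.card ≤ 2 ^ (Finset.Icc j.1 j.2.1).card := by
          rw [← Finset.card_powerset]
          refine Finset.card_le_card_of_injOn (fun g => g.left.toAdd.support) ?_ ?_
          · intro g hg
            have hg2 := (Finset.mem_filter.mp hg).2
            exact Finset.mem_powerset.mpr hg2.1
          · intro g hg g' hg' hgg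
            have hg2 := (Finset.mem_filter.mp hg).2
            have hg3 := (Finset.mem_filter.mp hg').2
            apply SemidirectProduct.ext
            · apply Multiplicative.toAdd.injective
              ext z
              have hz : z ∈ g.left.toAdd.support ↔ z ∈ g'.left.toAdd.support := by
                simp only at hgg
                rw [hgg]
              simp only [Finsupp.mem_support_iff] at hz
              have : ∀ a b : ZMod 2, (a ≠ 0 ↔ b ≠ 0) → a = b := by decide
              rw [this _ _ hz]
            · apply Multiplicative.toAdd.injective
              rw [hg2.2, hg3.2]
        have hc' : (Q.card : ℝ) ≤ 2 ^ (Finset.Icc j.1 j.2.1).card := by exact_mod_cast hc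
        calc (Q.card : ℝ) * (K⁻¹ * (2 ^ (Finset.Icc j.1 j.2.1).card)⁻¹)
            ≤ 2 ^ (Finset.Icc j.1 j.2.1).card * (K⁻¹ * (2 ^ (Finset.Icc j.1 j.2.1).card)⁻¹) :=
              mul_le_mul_of_nonneg_right hc' (by positivity)
          _ = K⁻¹ := by field_simp
      refine (Finset.sum_le_sum this).trans ?_
      rw [Finset.sum_const, nsmul_eq_mul, hJc, mul_inv_cancel₀ hK0.ne'])
  refine hg.trans ?_
  rw [← Finset.sum_neg_distrib]
  have h5 : ∀ x : Fin n → Ctl × Bits,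
      -((∏ i, wO ρ (x i)) * Real.log (q (PP (fun x => gst (stX x)) n x))) ≤
      (∏ i, wO ρ (x i)) * (Real.log 2 * ((Rs n (fun i => (x i).1)).card : ℝ) +
        3 * Real.log (2 * n + 1)) := by
    intro x
    rw [← mul_neg]
    refine mul_le_mul_of_nonneg_left ?_ (Finset.prod_nonneg fun i _ => (wO_pos hρ _).le)
    have := Real.log_le_log (by positivity) (hlow x)
    rw [Real.log_mul (by positivity) (by positivity), Real.log_inv, Real.log_inv, hK,
      Real.log_pow, Real.log_pow] at this
    push_cast at this
    linarith
  refine (Finset.sum_le_sum fun x _ => h5 x).trans (le_of_eq ?_)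
  rw [sum_split ρ n (fun c => Real.log 2 * ((Rs n c).card : ℝ) + 3 * Real.log (2 * n + 1)),
    Ex_add, Ex_mul, Ex_const (wC_sum ρ)]

lemma noise_lower {ρ : ℝ} (hρ : ρ ∈ Set.Ioo (0 : ℝ) 1) (n : ℕ) :
    2 * Real.log 2 * Ex (wC ρ) n (fun c => ((Vs n c).card : ℝ)) ≤
      entropy (convPow (noise muSWS ρ) n) := by
  classical
  rw [noise_eq, convPow_push, push_split]
  have := entropy_lower (C := Fin n → Ctl) (D := Fin n → Bits) (W := fun c => ∏ i, wC ρ (c i))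
    (fun c => Finset.prod_nonneg fun i _ => (wC_pos hρ _).le)
    (by rw [sum_prod_eq_Ex, Ex_const (wC_sum ρ)])
    (fun y => PP (fun x => (gst (stX x), gst (stY x))) n (fun i => (y.1 i, y.2 i)))
    (fun c => (Vs n c).card + (Vs n (fun i => swp (c i))).card) (by
      intro c g
      refine le_trans (Nat.mul_le_mul_right _ (Finset.card_le_card ?_))
        (fiber_bound n c (g.1.left.toAdd, g.2.left.toAdd))
      intro d hd
      simp only [Finset.mem_filter, Finset.mem_univ, true_and] at hd ⊢
      rw [← hd, PP_pair, PP_X, PP_Y_left]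
      rfl)
  refine le_trans (le_of_eq ?_) this
  have e : ∑ c : Fin n → Ctl, (∏ i, wC ρ (c i)) *
      (((Vs n c).card + (Vs n (fun i => swp (c i))).card : ℕ) : ℝ) =
      Ex (wC ρ) n (fun c => ((Vs n c).card : ℝ) + ((Vs n (fun i => swp (c i))).card : ℝ)) := by
    simp [Ex]
  rw [e, Ex_add, Ex_swp ρ n (fun c => ((Vs n c).card : ℝ))]
  ring

lemma noise_upper {ρ : ℝ} (hρ : ρ ∈ Set.Ioo (0 : ℝ) 1) (n : ℕ) :
    entropy (convPow (noise muSWS ρ) n) ≤ 2 * entropy (convPow muSWS n) := by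
  have h1 : entropy (convPow muSWS n) = entropy (push (fun x : Fin n → Ctl × Bits => ∏ i, wO ρ (x i))
    (PP (fun x => gst (stX x)) n)) := by
    rw [mu_eq_X ρ, convPow_push]
  have h2 : entropy (convPow muSWS n) = entropy (push (fun x : Fin n → Ctl × Bits => ∏ i, wO ρ (x i))
    (PP (fun x => gst (stY x)) n)) := by
    rw [mu_eq_Y ρ, convPow_push]
  rw [two_mul]
  nth_rw 1 [h1]
  rw [h2, noise_eq, convPow_push]
  have := entropy_pair_le (w := fun x : Fin n → Ctl × Bits => ∏ i, wO ρ (x i))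
    (fun x => Finset.prod_pos fun i _ => wO_pos hρ _) (sum_wO ρ n)
    (PP (fun x => gst (stX x)) n) (PP (fun x => gst (stY x)) n)
  refine le_trans (le_of_eq ?_) this
  congr 2
  funext x
  exact PP_pair _ _ n x

lemma refreshed_lower {ρ : ℝ} (hρ : ρ ∈ Set.Ioo (0 : ℝ) 1) {ε : ℝ} (hε : 0 < ε) :
    ∃ M : ℝ, ∀ n, (1 - ε) * Ex (wC ρ) n (fun c => ((Rs n c).card : ℝ)) - M ≤
      Ex (wC ρ) n (fun c => ((Vs n c).card : ℝ)) := by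
  obtain ⟨M, hM⟩ := Filter.eventually_atTop.mp ((Fr_tendsto hρ).eventually_le_const hε)
  refine ⟨M + 1, fun n => ?_⟩
  have h := unrefreshed_le hρ hε.le M (fun k hk => hM k hk.le) n ∅
  simp only [Finset.sdiff_empty] at h
  have h2 : Ex (wC ρ) n (fun c => ((Rs n c).card : ℝ)) ≤
      Ex (wC ρ) n (fun c => ((Vs n c).card : ℝ) + ((Rs n c \ Vs n c).card : ℝ)) := by
    refine Ex_mono (fun c => (wC_pos hρ c).le) n fun c => ?_
    have := Finset.card_le_card_sdiff_add_card (t := Vs n c) (s := Rs n c)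
    have h3 : (Rs n c).card ≤ (Vs n c).card + (Rs n c \ Vs n c).card := by omega
    exact_mod_cast h3
  rw [Ex_add] at h2
  linarith

lemma log_div_tendsto {A : ℕ → ℝ} (hA : ∀ n : ℕ, Real.sqrt n / 8 ≤ A n) (a M : ℝ) :
    Tendsto (fun n : ℕ => (a * Real.log (2 * n + 1) + M) / A n) atTop (nhds 0) := by
  have hpos : ∀ᶠ n : ℕ in atTop, 0 < Real.sqrt n / 8 := by
    filter_upwards [eventually_gt_atTop 0] with n hn
    have : (0:ℝ) < n := by exact_mod_cast hn
    positivity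
  have h1 : Tendsto (fun x : ℝ => Real.log x / x ^ (1/2 : ℝ)) atTop (nhds 0) :=
    (isLittleO_log_rpow_atTop (by norm_num)).tendsto_div_nhds_zero
  have hc : Tendsto (fun n : ℕ => (2 * n + 1 : ℝ)) atTop atTop :=
    tendsto_atTop_add_const_right _ _ (tendsto_natCast_atTop_atTop.const_mul_atTop (by norm_num))
  have hs : Tendsto (fun n : ℕ => Real.sqrt n) atTop atTop :=
    Real.tendsto_sqrt_atTop.comp tendsto_natCast_atTop_atTop
  have h2 := h1.comp hc
  have hM : Tendsto (fun n : ℕ => |M| * (8 * (Real.sqrt n)⁻¹)) atTop (nhds 0) := by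
    simpa using ((tendsto_inv_atTop_zero.comp hs).const_mul 8).const_mul |M|
  have hL : Tendsto (fun n : ℕ => |a| * (16 * (Real.log (2 * n + 1) / (2 * n + 1 : ℝ)^(1/2:ℝ)))
      + |M| * (8 * (Real.sqrt n)⁻¹)) atTop (nhds 0) := by
    simpa using ((h2.const_mul 16).const_mul |a|).add hM
  refine squeeze_zero_norm' ?_ hL
  filter_upwards [hpos, eventually_gt_atTop 0] with n hn hn0
  have hn1 : (1:ℝ) ≤ n := by exact_mod_cast hn0
  have hAn := hA n
  have hs0 : 0 < Real.sqrt n := by linarith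
  have hlog : 0 ≤ Real.log (2 * n + 1) := Real.log_nonneg (by linarith)
  have hs2 : Real.sqrt (2 * n + 1) ≤ 2 * Real.sqrt n := by
    rw [Real.sqrt_le_left (by positivity), mul_pow, Real.sq_sqrt (by linarith)]
    linarith
  have hs3 : 0 < Real.sqrt (2 * n + 1) := Real.sqrt_pos.mpr (by linarith)
  rw [norm_div, Real.norm_eq_abs, Real.norm_eq_abs, abs_of_pos (hn.trans_le hAn)]
  calc |a * Real.log (2 * n + 1) + M| / A n
      ≤ (|a| * Real.log (2 * n + 1) + |M|) / A n := by
        gcongr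
        · exact (hn.trans_le hAn).le
        · refine (abs_add_le _ _).trans ?_
          rw [abs_mul, abs_of_nonneg hlog]
    _ ≤ (|a| * Real.log (2 * n + 1) + |M|) / (Real.sqrt n / 8) := by gcongr
    _ = |a| * (8 * (Real.log (2 * n + 1) / Real.sqrt n)) + |M| * (8 * (Real.sqrt n)⁻¹) := by
        field_simp
    _ ≤ _ := by
        rw [← Real.sqrt_eq_rpow]
        have : Real.log (2 * n + 1) / Real.sqrt n ≤ 2 * (Real.log (2 * n + 1) / Real.sqrt (2 * n + 1)) := by
          rw [← mul_div_assoc, div_le_div_iff₀ hs0 hs3]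
          nlinarith
        have h3 : 8 * (Real.log (2 * n + 1) / Real.sqrt n) ≤
          16 * (Real.log (2 * n + 1) / Real.sqrt (2 * n + 1)) := by linarith
        have := mul_le_mul_of_nonneg_left h3 (abs_nonneg a)
        linarith

/-- The lamplighter group `ℤ/2ℤ ≀ ℤ` with the
switch-walk-switch measure is entropy noise sensitive. -/
theorem lamplighter_entropyNS : EntropyNoiseSensitive muSWS := by
  intro ρ hρ
  set A : ℕ → ℝ := fun n => Ex (wC ρ) n (fun c => ((Rs n c).card : ℝ)) with hAdef
  have hA : ∀ n : ℕ, Real.sqrt n / 8 ≤ A n := range_lower hρ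
  have hl2 : 0 < Real.log 2 := Real.log_pos (by norm_num)
  have hApos : ∀ᶠ n : ℕ in atTop, 0 < A n := by
    filter_upwards [eventually_gt_atTop 0] with n hn
    have : (0:ℝ) < n := by exact_mod_cast hn
    exact lt_of_lt_of_le (by positivity) (hA n)
  -- eventual lower bound
  have low : ∀ ε : ℝ, 0 < ε → ∀ᶠ n : ℕ in atTop,
      (2 - ε) * A n * Real.log 2 ≤ entropy (convPow (noise muSWS ρ) n) ∧
      entropy (convPow muSWS n) ≤ (1 + ε) * A n * Real.log 2 := by
    intro ε hε
    obtain ⟨M, hM⟩ := refreshed_lower hρ (show 0 < ε / 4 by linarith)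
    have t1 := (log_div_tendsto hA 0 M).eventually_le_const (show 0 < ε / 4 by linarith)
    have t2 := (log_div_tendsto hA 3 0).eventually_le_const (show 0 < ε * Real.log 2 by positivity)
    filter_upwards [t1, t2, hApos] with n h1 h2 h3
    rw [div_le_iff₀ h3] at h1 h2
    constructor
    · refine le_trans ?_ (noise_lower hρ n)
      have := hM n
      have h4 : (1 - ε / 2) * A n ≤ Ex (wC ρ) n (fun c => ((Vs n c).card : ℝ)) := by
        have : (1 - ε / 4) * A n - M ≤ Ex (wC ρ) n (fun c => ((Vs n c).card : ℝ)) := this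
        linarith
      have := mul_le_mul_of_nonneg_left h4 (show 0 ≤ 2 * Real.log 2 by positivity)
      linarith
    · have := entropy_upper hρ n
      have : entropy (convPow muSWS n) ≤ Real.log 2 * A n + 3 * Real.log (2 * n + 1) := this
      linarith
  have hpos : ∀ᶠ n : ℕ in atTop, 0 < entropy (convPow muSWS n) := by
    filter_upwards [low 1 one_pos, hApos] with n hn h3
    have h5 := noise_upper hρ n
    have : 0 < (2 - 1) * A n * Real.log 2 := by
      have := mul_pos h3 hl2
      linarith
    linarith [hn.1]
  rw [Metric.tendsto_atTop']
  intro δ hδ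
  set ε : ℝ := min (δ / 8) 1 with hεd
  have hε : 0 < ε := lt_min (by linarith) one_pos
  have hε1 : ε ≤ 1 := min_le_right _ _
  have hεδ : ε ≤ δ / 8 := min_le_left _ _
  have fin : ∀ᶠ n : ℕ in atTop, dist ((entropy (convPow (noise muSWS ρ) n) - entropy (convPow muSWS n))
        / entropy (convPow muSWS n)) 1 < δ := by
    filter_upwards [low ε hε, hpos, hApos] with n hn hp h3
    obtain ⟨h1, h2⟩ := hn
    have h5 := noise_upper hρ n
    set Hn := entropy (convPow (noise muSWS ρ) n)
    set H := entropy (convPow muSWS n)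
    rw [Real.dist_eq, abs_lt]
    have e : (Hn - H) / H - 1 = (Hn - 2 * H) / H := by field_simp; ring
    rw [e]
    constructor
    · rw [lt_div_iff₀ hp]
      have hB : 0 < A n * Real.log 2 := mul_pos h3 hl2
      -- Hn ≥ (2-ε) B, 2 H ≤ 2(1+ε) B, H ≥ (2-ε)/2 B
      set B := A n * Real.log 2
      have g1 : (2 - ε) * B ≤ Hn := by simp only [B]; linarith
      have g2 : H ≤ (1 + ε) * B := by simp only [B]; linarith
      -- it suffices that 2H - Hn < δ H
      have g3 : 2 * H - Hn ≤ 3 * ε * B := by linarith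
      have g4 : (2 - ε) * B ≤ 2 * H := by linarith
      have g5 : B ≤ 2 * H := by nlinarith
      have g6 : 3 * ε * B ≤ 3 * ε * (2 * H) := mul_le_mul_of_nonneg_left g5 (by positivity)
      have g7 : ε * H ≤ δ / 8 * H := mul_le_mul_of_nonneg_right hεδ hp.le
      have g8 : 0 < δ * H := mul_pos hδ hp
      linarith
    · rw [div_lt_iff₀ hp]
      have : 0 < δ * H := by positivity
      linarith
  exact (Filter.eventually_atTop.mp fin).imp fun N hN n hn => hN n (le_of_lt hn)

end NS
end

section
/- Let G be a countable group and μ a probability measure on G. If (G,μ) is ℓ¹-noise sensitive, then ‖μ^diag * (μ_{n−1}×μ_{n−1}) − μ_n×μ_n‖₁ → 0 as n → ∞, where * denotes convolution of probability measures on the group G×G. -/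
open Filter

namespace NS

theorem aux_sum2 {H : Type*} [Group H] {f g : H → ℝ} (hf : Summable f) (hg : Summable g) :
    Summable (fun p : H × H => f p.1 * g (p.1⁻¹ * p.2)) := by
  have h1 : Summable (fun p : H × H => f p.1 * g p.2) :=
    summable_mul_of_summable_norm hf.norm hg.norm
  let e : H × H ≃ H × H :=
    { toFun := fun p => (p.1, p.1⁻¹ * p.2)
      invFun := fun p => (p.1, p.1 * p.2)
      left_inv := fun p => by simp
      right_inv := fun p => by simp }
  exact (e.summable_iff (f := fun p : H × H => f p.1 * g p.2)).2 h1

theorem aux_sum_fib {H : Type*} [Group H] {f g : H → ℝ} (hf : Summable f) (hg : Summable g)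
    (x : H) : Summable (fun h => f h * g (h⁻¹ * x)) :=
  ((aux_sum2 hf hg).prod_symm).prod_factor x

theorem aux_conv_summable {H : Type*} [Group H] {f g : H → ℝ} (hf : Summable f)
    (hg : Summable g) : Summable (conv f g) :=
  ((aux_sum2 hf hg).prod_symm).prod

theorem aux_conv_norm {H : Type*} [Group H] {f g : H → ℝ} (hf : Summable f)
    (hg : Summable g) : ∑' x, |conv f g x| ≤ (∑' x, |f x|) * ∑' x, |g x| := by
  have hs := aux_sum2 hf.abs hg.abs
  have h1 : ∑' x, |conv f g x| ≤ ∑' x, conv (fun x => |f x|) (fun x => |g x|) x := by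
    refine Summable.tsum_le_tsum (fun x => ?_) (aux_conv_summable hf hg).abs
      (aux_conv_summable hf.abs hg.abs)
    have h2 := (aux_sum_fib hf hg x).norm
    have h3 := norm_tsum_le_tsum_norm h2
    simp only [Real.norm_eq_abs, abs_mul] at h3
    exact h3
  refine h1.trans (le_of_eq ?_)
  have h4 : ∑' x, ∑' h, |f h| * |g (h⁻¹ * x)| = ∑' h, ∑' x, |f h| * |g (h⁻¹ * x)| :=
    Summable.tsum_comm (f := fun h x => |f h| * |g (h⁻¹ * x)|) hs
  have h5 : ∀ h : H, ∑' x, |f h| * |g (h⁻¹ * x)| = |f h| * ∑' x, |g x| := by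
    intro h
    rw [tsum_mul_left]
    congr 1
    exact (Equiv.mulLeft h⁻¹).tsum_eq (fun x => |g x|)
  change ∑' x, ∑' h, |f h| * |g (h⁻¹ * x)| = _
  rw [h4, tsum_congr h5, tsum_mul_right]

theorem aux_convPow_summable {H : Type*} [Group H] {f : H → ℝ} (hf : Summable f) (n : ℕ) :
    Summable (convPow f n) := by
  induction n with
  | zero =>
    refine summable_of_ne_finset_zero (s := {1}) (fun b hb => ?_)
    simp only [convPow]
    exact Set.indicator_of_notMem (by simpa using hb) _
  | succ n ih => exact aux_conv_summable hf ih

theorem aux_prodM_summable {H : Type*} {f g : H → ℝ} (hf : Summable f)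
    (hg : Summable g) : Summable (prodM f g) :=
  summable_mul_of_summable_norm hf.norm hg.norm

theorem aux_diag_summable {G : Type*} [Group G] {f : G → ℝ} (hf : Summable f) :
    Summable (diagM f) := by
  have hi : Function.Injective (fun g : G => (g, g)) := fun a b h => (Prod.mk.inj h).1
  refine (hi.summable_iff ?_).1 ?_
  · intro p hp
    refine Set.indicator_of_notMem (fun h => hp ⟨p.1, ?_⟩) _
    exact Prod.ext rfl h
  · refine hf.congr (fun g => ?_)
    simp [diagM]

theorem aux_conv_prodM {G : Type*} [Group G] {f g : G → ℝ} (hf : Summable f)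
    (hg : Summable g) : conv (prodM f f) (prodM g g) = prodM (conv f g) (conv f g) := by
  funext p
  have h := tsum_mul_tsum_of_summable_norm (aux_sum_fib hf hg p.1).norm
    (aux_sum_fib hf hg p.2).norm
  simp only [conv, prodM]
  rw [h]
  refine tsum_congr (fun q => ?_)
  simp only [Prod.fst_mul, Prod.snd_mul, Prod.fst_inv, Prod.snd_inv]
  ring

/-- If `(G,μ)` is `ℓ¹`-noise sensitive, then
`‖μ^diag * (μ_n × μ_n) - μ_{n+1} × μ_{n+1}‖₁ → 0`. -/
theorem l1NS_firstDigit {G : Type*} [Group G] [Countable G] (μ : G → ℝ)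
    (hprob : IsProbMeasure μ) (hNS : L1NoiseSensitive μ) :
    Tendsto
      (fun n => l1dist
        (conv (diagM μ) (prodM (convPow μ n) (convPow μ n)))
        (prodM (convPow μ (n + 1)) (convPow μ (n + 1))))
      atTop (nhds 0) := by
  have hμ : Summable μ := by
    by_contra h
    have := hprob.2
    rw [tsum_eq_zero_of_not_summable h] at this
    exact zero_ne_one this
  have hd := aux_diag_summable hμ
  have hp := aux_prodM_summable hμ hμ
  have hN : Summable (noise μ (1 / 2)) :=
    (hd.mul_left (1 - 1 / 2)).add (hp.mul_left (1 / 2))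
  have hT := hNS (1 / 2) ⟨by norm_num, by norm_num⟩
  set C := ∑' x, |noise μ (1 / 2) x| with hC
  have hT' := hT.comp (tendsto_add_atTop_nat 1)
  have hlim := ((hT.const_mul C).add hT').const_mul 2
  simp only [mul_zero, add_zero] at hlim
  refine squeeze_zero (fun n => tsum_nonneg (fun _ => abs_nonneg _)) (fun n => ?_) hlim
  have hm := aux_convPow_summable hμ n
  have hm1 := aux_convPow_summable hμ (n + 1)
  have hP := aux_prodM_summable hm hm
  have hP1 := aux_prodM_summable hm1 hm1
  have hQ := aux_convPow_summable hN n
  have hQ1 := aux_convPow_summable hN (n + 1)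
  let D : G × G → ℝ := fun x =>
    convPow (noise μ (1 / 2)) n x - prodM (convPow μ n) (convPow μ n) x
  have hD : Summable D := hQ.sub hP
  have hcD := (aux_conv_summable hN hD).abs
  have hE := (hQ1.sub hP1).abs
  have hb : C * ∑' x, |D x| ≥ ∑' x, |conv (noise μ (1 / 2)) D x| := aux_conv_norm hN hD
  have key : ∀ x, conv (diagM μ) (prodM (convPow μ n) (convPow μ n)) x
      - prodM (convPow μ (n + 1)) (convPow μ (n + 1)) x
      = 2 * ((convPow (noise μ (1 / 2)) (n + 1) x
        - prodM (convPow μ (n + 1)) (convPow μ (n + 1)) x)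
        - conv (noise μ (1 / 2)) D x) := by
    intro x
    have e1 : conv (noise μ (1 / 2)) D x = convPow (noise μ (1 / 2)) (n + 1) x
        - conv (noise μ (1 / 2)) (prodM (convPow μ n) (convPow μ n)) x := by
      simp only [convPow, conv]
      rw [← (aux_sum_fib hN hQ x).tsum_sub (aux_sum_fib hN hP x)]
      exact tsum_congr (fun h => mul_sub _ _ _)
    have e2 : conv (noise μ (1 / 2)) (prodM (convPow μ n) (convPow μ n)) x
        = 1 / 2 * conv (diagM μ) (prodM (convPow μ n) (convPow μ n)) x
        + 1 / 2 * conv (prodM μ μ) (prodM (convPow μ n) (convPow μ n)) x := by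
      simp only [conv]
      rw [← tsum_mul_left, ← tsum_mul_left, ← ((aux_sum_fib hd hP x).mul_left (1 / 2)).tsum_add
        ((aux_sum_fib hp hP x).mul_left (1 / 2))]
      refine tsum_congr (fun h => ?_)
      simp only [noise]
      ring
    have e3 : conv (prodM μ μ) (prodM (convPow μ n) (convPow μ n)) x
        = prodM (convPow μ (n + 1)) (convPow μ (n + 1)) x :=
      congrFun (aux_conv_prodM hμ hm) x
    rw [e1, e2, e3]
    ring
  have hle : ∀ x, |conv (diagM μ) (prodM (convPow μ n) (convPow μ n)) x
      - prodM (convPow μ (n + 1)) (convPow μ (n + 1)) x|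
      ≤ 2 * (|conv (noise μ (1 / 2)) D x| + |convPow (noise μ (1 / 2)) (n + 1) x
        - prodM (convPow μ (n + 1)) (convPow μ (n + 1)) x|) := by
    intro x
    rw [key, abs_mul, abs_two]
    have := abs_sub (convPow (noise μ (1 / 2)) (n + 1) x
        - prodM (convPow μ (n + 1)) (convPow μ (n + 1)) x) (conv (noise μ (1 / 2)) D x)
    linarith
  have hfin := Summable.tsum_le_tsum hle
    (((aux_conv_summable hd hP).sub hP1).abs) ((hcD.add hE).mul_left 2)
  rw [tsum_mul_left, hcD.tsum_add hE] at hfin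
  simp only [l1dist, Function.comp]
  change _ ≤ 2 * (C * (∑' x, |D x|) + _)
  linarith

end NS
end
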